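/- Let P be a simplicial poset, α ∈ ℤ_{≤0}ⁿ with αⱼ < −1 for a fixed index j, and γ = α + eⱼ. Under the identifications H_m^i(A_P)_α ≅ ⊕_{supp(w)=supp(α)} H^{i−1}(P, cost_P(w)) and H_m^i(A_P)_γ ≅ ⊕_{supp(w)=supp(γ)} H^{i−1}(P, cost_P(w)), the multiplication map ·xⱼ : H_m^i(A_P)_α → H_m^i(A_P)_γ corresponds to the direct sum of identity maps (note supp(α) = supp(γ) in this case). -/

import Mathlib

open scoped Classical
open MvPolynomial

noncomputable section

def IsSimplicialPoset (P : Type*) [Fintype P] [PartialOrder P] [OrderBot P] : Prop :=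
  ∀ y : P, ∃ m : ℕ, Nonempty (Set.Icc (⊥ : P) y ≃o Finset (Fin m))

def MUB {P : Type*} [PartialOrder P] (w y : P) : Set P :=
  {z | z ∈ upperBounds {w, y} ∧ ∀ z' ∈ upperBounds {w, y}, z' ≤ z → z' = z}

variable (P : Type) [Fintype P] [PartialOrder P] [OrderBot P]
variable (k : Type) [Field k]

/-- The defining ideal of the face ring of a simplicial poset. -/
def faceIdeal : Ideal (MvPolynomial P k) :=
  Ideal.span
    ({f | ∃ w y : P, upperBounds {w, y} = ∅ ∧ f = X w * X y} ∪
     {f | ∃ w y m : P, (upperBounds {w, y}).Nonempty ∧ IsGLB {w, y} m ∧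
        f = X w * X y - X m * ∑ z ∈ (Set.toFinite (MUB w y)).toFinset, X z} ∪
     {X (⊥ : P) - 1})

/-- The face ring `A_P = k[P]/I_P` of a simplicial poset. -/
abbrev FaceRing := MvPolynomial P k ⧸ faceIdeal P k

/-- The class of the variable corresponding to a face `y` in the face ring. -/
def fv (y : P) : FaceRing P k := Ideal.Quotient.mk _ (X y)

/-- `r` is a standard monomial with leading variable `z`: a product of powers of
variables along a strictly decreasing chain starting at `z`, with positive exponents. -/
def IsStdMonLead (r : FaceRing P k) (z : P) : Prop :=
  ∃ (c : ℕ) (w : Fin (c + 1) → P) (p : Fin (c + 1) → ℕ),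
    StrictAnti w ∧ (∀ i, 0 < p i) ∧ w 0 = z ∧ r = ∏ i, (fv P k (w i)) ^ (p i)

variable (n : ℕ) (x : Fin n → P)

/-- The ℤⁿ-graded piece of the face ring of degree `α`, with respect to the atom
labelling `x : Fin n → P`: the span of (classes of) monomials of `k[P]` whose
ℤⁿ-degree (each face `y` contributing `e_i` for every atom `x i ≤ y`) is `α`. -/
def facePiece (α : Fin n → ℤ) : Submodule k (FaceRing P k) :=
  Submodule.span k
    {r | ∃ σ : P →₀ ℕ,
      (∀ j : Fin n, (∑ y ∈ σ.support, if x j ≤ y then (σ y : ℤ) else 0) = α j) ∧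
      r = Ideal.Quotient.mk _ (monomial σ (1 : k))}

/-- Cochains of the complex `Hom_A(K_•^ℓ, A_P)`: a free basis of `K_t^ℓ` is indexed by
`t`-subsets of `Fin n`, so `Hom_A(K_t^ℓ, A_P)` is identified with functions from
`t`-subsets to `A_P`; we take functions on all finite subsets at once. -/
abbrev KCochain := Finset (Fin n) → FaceRing P k

/-- The differential of `Hom_A(K_•^ℓ, A_P)`:
`(df)(G) = Σ_{j ∈ G} (-1)^{|{i ∈ G : i < j}|} x_j^ℓ · f(G \ {j})`. -/
def koszulD (ℓ : ℕ) : KCochain P k n →ₗ[k] KCochain P k n :=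
  LinearMap.pi fun G =>
    ∑ j ∈ G, ((-1 : k) ^ ((G.filter fun i => i < j).card)) •
      ((LinearMap.mulLeft k ((fv P k (x j)) ^ ℓ)).comp (LinearMap.proj (G.erase j)))

/-- The degree-`(t, α)` graded piece of the Koszul cochains: functions supported on
`t`-subsets `G`, with value at `G` in the graded piece of degree `α + ℓ·χ_G`. -/
def gradedKC (ℓ t : ℕ) (α : Fin n → ℤ) : Submodule k (KCochain P k n) :=
  Submodule.pi Set.univ fun G =>
    if G.card = t then facePiece P k n x (fun j => α j + if j ∈ G then (ℓ : ℤ) else 0)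
    else ⊥

/-- Cocycles of degree `(t, α)`. -/
def ZK (ℓ t : ℕ) (α : Fin n → ℤ) : Submodule k (KCochain P k n) :=
  LinearMap.ker (koszulD P k n x ℓ) ⊓ gradedKC P k n x ℓ t α

/-- Coboundaries of degree `(t, α)`. -/
def BK (ℓ t : ℕ) (α : Fin n → ℤ) : Submodule k (KCochain P k n) :=
  Submodule.map (koszulD P k n x ℓ) (gradedKC P k n x ℓ (t - 1) α)

/-- The graded piece `Ext_A^t(A/m_ℓ, A_P)_α`, computed as degree-`(t,α)` cohomology
of the complex `Hom_A(K_•^ℓ, A_P)`. -/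
abbrev ExtPiece (ℓ t : ℕ) (α : Fin n → ℤ) :=
  ↥(ZK P k n x ℓ t α) ⧸
    Submodule.comap (ZK P k n x ℓ t α).subtype (BK P k n x ℓ t α)


/-- The cochain-level map `π̂^* : Hom_A(K_•^ℓ, A_P) → Hom_A(K_•^{ℓ+1}, A_P)` induced by
the comparison `π̂ : K_•^{ℓ+1} → K_•^ℓ` of Koszul complexes covering the projection
`A/m_{ℓ+1} → A/m_ℓ`: `(π̂^* f)(F) = (∏_{j ∈ F} x_j) · f(F)`. -/
def transKC : KCochain P k n →ₗ[k] KCochain P k n :=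
  LinearMap.pi fun G =>
    (LinearMap.mulLeft k (∏ j ∈ G, fv P k (x j))).comp (LinearMap.proj G)

set_option synthInstance.maxHeartbeats 1000000 in
/-- The transition map `Ext_A^t(A/m_ℓ, A_P)_α → Ext_A^t(A/m_{ℓ+1}, A_P)_α` induced by
`π̂^*` (the structure map of the directed system computing local cohomology). -/
def transExt (ℓ t : ℕ) (α : Fin n → ℤ) :
    ExtPiece P k n x ℓ t α →ₗ[k] ExtPiece P k n x (ℓ + 1) t α := by
  classical
  exact if h : ∃ g : ↥(ZK P k n x ℓ t α) →ₗ[k] ↥(ZK P k n x (ℓ + 1) t α),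
      (∀ v : ↥(ZK P k n x ℓ t α),
        (g v : KCochain P k n) = transKC P k n x (v : KCochain P k n)) ∧
      Submodule.comap (ZK P k n x ℓ t α).subtype (BK P k n x ℓ t α) ≤
        (Submodule.comap (ZK P k n x (ℓ + 1) t α).subtype
          (BK P k n x (ℓ + 1) t α)).comap g
  then Submodule.mapQ _ _ h.choose h.choose_spec.2 else 0

/-- Iterated transition maps of the directed system `ℓ ↦ Ext_A^t(A/m_ℓ, A_P)_α`. -/
def transChain (t : ℕ) (α : Fin n → ℤ) {i j : ℕ} (h : i ≤ j) :
    ExtPiece P k n x i t α →ₗ[k] ExtPiece P k n x j t α :=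
  Nat.leRecOn h (fun {m} g => (transExt P k n x m t α).comp g) LinearMap.id

/-- The graded piece `H_m^t(A_P)_α` of local cohomology: the direct limit over `ℓ` of
`Ext_A^t(A/m_ℓ, A_P)_α` along the transition maps induced by the projections
`A/m_{ℓ+1} → A/m_ℓ`. -/
abbrev LocCoh (t : ℕ) (α : Fin n → ℤ) :=
  Module.DirectLimit (R := k) (ι := ℕ) (fun ℓ => ExtPiece P k n x ℓ t α)
    (fun _ _ h => transChain P k n x t α h)


section Cohomology
variable (Q : Type) [Fintype Q] [PartialOrder Q]

/-- The simplicial coboundary operator of a complex `K` of finite chains in a poset `Q`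
(each face being a chain is canonically oriented by the order of `Q`):
`(δf)(s) = Σ_{v ∈ s} (-1)^{|{u ∈ s : u < v}|} f(s \ {v})` for `s ∈ K`, and `0` otherwise. -/
def cDelta (K : Set (Finset Q)) : (Finset Q → k) →ₗ[k] (Finset Q → k) :=
  LinearMap.pi fun s =>
    if s ∈ K then
      ∑ v ∈ s, ((-1 : k) ^ ((s.filter fun u => u < v).card)) • LinearMap.proj (s.erase v)
    else 0

/-- Cochains of (cohomological) degree `i`: functions supported on faces of `K` with
`i + 1` vertices. -/
def cGraded (K : Set (Finset Q)) (i : ℤ) : Submodule k (Finset Q → k) :=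
  Submodule.pi Set.univ fun s => if s ∈ K ∧ (s.card : ℤ) = i + 1 then ⊤ else ⊥

/-- Degree-`i` cocycles. -/
def ZC (K : Set (Finset Q)) (i : ℤ) : Submodule k (Finset Q → k) :=
  LinearMap.ker (cDelta k Q K) ⊓ cGraded k Q K i

/-- Degree-`i` coboundaries. -/
def BC (K : Set (Finset Q)) (i : ℤ) : Submodule k (Finset Q → k) :=
  Submodule.map (cDelta k Q K) (cGraded k Q K (i - 1))

/-- The degree-`i` cohomology (with coefficients in `k`) of a complex `K` of chains
in `Q`. -/
abbrev Coh (K : Set (Finset Q)) (i : ℤ) :=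
  ↥(ZC k Q K i) ⧸ Submodule.comap (ZC k Q K i).subtype (BC k Q K i)

/-- The full complex of chains of `Q` minus its minimal elements: the order complex
`Δ(Q̄)` (including the empty face, so `Coh` of it is *reduced* cohomology). -/
def chainsK : Set (Finset Q) :=
  {s | (∀ q ∈ s, ¬ IsMin q) ∧ IsChain (· ≤ ·) (↑s : Set Q)}

/-- Reduced cohomology `H̃^i(Q)` of (the order complex of) a poset `Q`. -/
abbrev ReducedCoh (i : ℤ) := Coh k Q (chainsK Q) i

/-- The relative complex of the pair `(Q, R)` for a subset `R ⊆ Q`: faces of the order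
complex of `Q` not lying in `R`; `Coh` of it is the relative cohomology `H^i(Q, R)`. -/
def relK (R : Set Q) : Set (Finset Q) :=
  {s | s ∈ chainsK Q ∧ ¬ (↑s : Set Q) ⊆ R}

/-- Relative cohomology `H^i(Q, R)`. -/
abbrev RelCoh (R : Set Q) (i : ℤ) := Coh k Q (relK Q R) i

/-- The link of a face `F` of the order complex of `Q`. -/
def linkK (F : Finset Q) : Set (Finset Q) :=
  {s | (∀ q ∈ s, q ∉ F) ∧ (∀ q ∈ s ∪ F, ¬ IsMin q) ∧
    IsChain (· ≤ ·) (↑(s ∪ F) : Set Q)}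
end Cohomology

/-- The contrastar `cost_P(y) = {z : ¬ y ≤ z}`. -/
def cost {P : Type} [PartialOrder P] (y : P) : Set P := {z | ¬ y ≤ z}

/-- The cochain-level map given by multiplication by the atom variable `x j`. -/
def mulKC (j : Fin n) : KCochain P k n →ₗ[k] KCochain P k n :=
  LinearMap.pi fun G => (LinearMap.mulLeft k (fv P k (x j))).comp (LinearMap.proj G)

set_option synthInstance.maxHeartbeats 1000000 in
/-- Multiplication by `x j` on graded pieces of Ext:
`·x_j : Ext_A^t(A/m_ℓ, A_P)_α → Ext_A^t(A/m_ℓ, A_P)_γ` where `γ = α + e_j`. -/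
def extMul (j : Fin n) (ℓ t : ℕ) (α γ : Fin n → ℤ) :
    ExtPiece P k n x ℓ t α →ₗ[k] ExtPiece P k n x ℓ t γ := by
  classical
  exact if h : ∃ g : ↥(ZK P k n x ℓ t α) →ₗ[k] ↥(ZK P k n x ℓ t γ),
      (∀ v : ↥(ZK P k n x ℓ t α),
        (g v : KCochain P k n) = mulKC P k n x j (v : KCochain P k n)) ∧
      Submodule.comap (ZK P k n x ℓ t α).subtype (BK P k n x ℓ t α) ≤
        (Submodule.comap (ZK P k n x ℓ t γ).subtype (BK P k n x ℓ t γ)).comap g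
  then Submodule.mapQ _ _ h.choose h.choose_spec.2 else 0

set_option synthInstance.maxHeartbeats 1000000 in
/-- Multiplication by `x j` on graded pieces of local cohomology:
`·x_j : H_m^t(A_P)_α → H_m^t(A_P)_γ` where `γ = α + e_j`, induced on direct limits by
the maps `extMul`. -/
def locMul (j : Fin n) (t : ℕ) (α γ : Fin n → ℤ) :
    LocCoh P k n x t α →ₗ[k] LocCoh P k n x t γ := by
  classical
  exact if h : ∀ (a b : ℕ) (hab : a ≤ b) (v : ExtPiece P k n x a t α),
      ((Module.DirectLimit.of k ℕ (fun m => ExtPiece P k n x m t γ)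
          (fun _ _ hcd => transChain P k n x t γ hcd) b).comp (extMul P k n x j b t α γ))
        (transChain P k n x t α hab v) =
      ((Module.DirectLimit.of k ℕ (fun m => ExtPiece P k n x m t γ)
          (fun _ _ hcd => transChain P k n x t γ hcd) a).comp (extMul P k n x j a t α γ)) v
  then Module.DirectLimit.lift k ℕ (fun m => ExtPiece P k n x m t α)
        (fun _ _ hab => transChain P k n x t α hab)
        (fun a => (Module.DirectLimit.of k ℕ (fun m => ExtPiece P k n x m t γ)
          (fun _ _ hcd => transChain P k n x t γ hcd) a).comp (extMul P k n x j a t α γ)) h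
  else 0


set_option linter.unusedSectionVars false

section Combin
variable {P k n x}

/-- support of a face -/
def sp (x : Fin n → P) (z : P) : Finset (Fin n) := Finset.univ.filter fun i => x i ≤ z

theorem mem_sp {z : P} {i : Fin n} : i ∈ sp x z ↔ x i ≤ z := by simp [sp]

theorem sp_mono {y z : P} (h : y ≤ z) : sp x y ⊆ sp x z := fun i hi =>
  mem_sp.2 ((mem_sp.1 hi).trans h)

structure Good (x : Fin n → P) : Prop where
  hP : IsSimplicialPoset P
  hinj : Function.Injective x
  hatom : ∀ i, IsAtom (x i)
  hsurj : ∀ a : P, IsAtom a → ∃ i, x i = a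

/-- one-element subsets correspond to atoms -/
theorem Good.exists_atom (g : Good x) {z : P} {m : ℕ} (e : Set.Icc (⊥ : P) z ≃o Finset (Fin m))
    (a : Fin m) : ∃ i, x i = (e.symm {a} : P) := by
  apply g.hsurj
  have hb : e ⟨⊥, le_rfl, bot_le⟩ = ∅ := by
    have h1 : (⟨⊥, le_rfl, bot_le⟩ : Set.Icc (⊥ : P) z) ≤ e.symm ∅ := (e.symm ∅).2.1
    have := (e.le_symm_apply).1 h1
    simpa using this
  constructor
  · intro h
    have : e.symm {a} = ⟨⊥, le_rfl, bot_le⟩ := Subtype.ext h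
    have h2 : e (e.symm {a}) = ∅ := by rw [this, hb]
    simp at h2
  · intro b hlt
    have hbz : b ≤ z := hlt.le.trans (e.symm {a}).2.2
    have h1 : (⟨b, bot_le, hbz⟩ : Set.Icc (⊥ : P) z) < e.symm {a} := hlt
    have h2 : e ⟨b, bot_le, hbz⟩ < {a} := by
      have := e.lt_iff_lt.2 h1
      simpa using this
    have h3 : e ⟨b, bot_le, hbz⟩ = ∅ := by
      have h4 := Finset.ssubset_singleton_iff.1 h2
      exact h4
    rw [← hb] at h3
    have := e.injective h3
    exact congrArg Subtype.val this

theorem Good.exists_sing (g : Good x) {z : P} {m : ℕ} (e : Set.Icc (⊥ : P) z ≃o Finset (Fin m))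
    (i : Fin n) (hi : x i ≤ z) : ∃ a, x i = (e.symm {a} : P) := by
  have hne : (e ⟨x i, bot_le, hi⟩).Nonempty := by
    by_contra h
    rw [Finset.not_nonempty_iff_eq_empty] at h
    have h1 : e ⟨x i, bot_le, hi⟩ ≤ e ⟨⊥, le_rfl, bot_le⟩ := by rw [h]; exact bot_le
    have h2 : x i ≤ ⊥ := e.le_iff_le.1 h1
    exact (g.hatom i).1 (le_bot_iff.1 h2)
  obtain ⟨a, ha⟩ := hne
  refine ⟨a, ?_⟩
  have h1 : ({a} : Finset (Fin m)) ≤ e ⟨x i, bot_le, hi⟩ := by simpa using ha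
  have h2 : e.symm {a} ≤ ⟨x i, bot_le, hi⟩ := (e.symm_apply_le).2 h1
  obtain ⟨i', hi'⟩ := g.exists_atom e a
  have h3 : (e.symm {a} : P) ≤ x i := h2
  rcases (g.hatom i).le_iff.1 h3 with h | h
  · exact absurd (hi'.trans h) (g.hatom i').1
  · exact h.symm

theorem Good.le_of_sp (g : Good x) {y y' z : P} (h : y ≤ z) (h' : y' ≤ z)
    (hs : sp x y ⊆ sp x y') : y ≤ y' := by
  obtain ⟨m, ⟨e⟩⟩ := g.hP z
  have : e ⟨y, bot_le, h⟩ ≤ e ⟨y', bot_le, h'⟩ := by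
    intro a ha
    obtain ⟨i, hi⟩ := g.exists_atom e a
    have h1 : ({a} : Finset (Fin m)) ≤ e ⟨y, bot_le, h⟩ := by simpa using ha
    have h2 : (e.symm {a} : P) ≤ y := (e.symm_apply_le).2 h1
    have h3 : x i ≤ y' := mem_sp.1 (hs (mem_sp.2 (hi ▸ h2)))
    rw [hi] at h3
    have h4 : e.symm {a} ≤ ⟨y', bot_le, h'⟩ := h3
    have h5 := (e.symm_apply_le).1 h4
    simpa using h5
  exact e.le_iff_le.1 this

theorem Good.eq_of_sp (g : Good x) {y y' z : P} (h : y ≤ z) (h' : y' ≤ z)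
    (hs : sp x y = sp x y') : y = y' :=
  le_antisymm (g.le_of_sp h h' hs.le) (g.le_of_sp h' h hs.ge)

theorem Good.exists_face (g : Good x) (z : P) (T : Finset (Fin n)) :
    ∃ y, y ≤ z ∧ sp x y = T ∩ sp x z := by
  obtain ⟨m, ⟨e⟩⟩ := g.hP z
  let S : Finset (Fin m) := Finset.univ.filter fun a => ∃ i ∈ T, x i = (e.symm {a} : P)
  refine ⟨(e.symm S : P), (e.symm S).2.2, ?_⟩
  ext i
  rw [mem_sp, Finset.mem_inter, mem_sp]
  constructor
  · intro hi
    have hz : x i ≤ z := hi.trans (e.symm S).2.2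
    refine ⟨?_, hz⟩
    obtain ⟨a, ha⟩ := g.exists_sing e i hz
    rw [ha] at hi
    have h1 : e.symm {a} ≤ e.symm S := hi
    have h2 : ({a} : Finset (Fin m)) ≤ S := e.symm.le_iff_le.1 h1
    have h3 : a ∈ S := by simpa using h2
    obtain ⟨i', hi', h4⟩ := (Finset.mem_filter.1 h3).2
    rw [← ha] at h4
    rwa [← g.hinj h4]
  · rintro ⟨hT, hz⟩
    obtain ⟨a, ha⟩ := g.exists_sing e i hz
    have h3 : a ∈ S := Finset.mem_filter.2 ⟨Finset.mem_univ _, i, hT, ha⟩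
    have h2 : ({a} : Finset (Fin m)) ≤ S := by simpa using h3
    have h1 : e.symm {a} ≤ e.symm S := e.symm.le_iff_le.2 h2
    rw [ha]; exact h1

/-- the face of `z` with support `T ∩ sp z` -/
def fc (g : Good x) (z : P) (T : Finset (Fin n)) : P := (g.exists_face z T).choose

theorem fc_le (g : Good x) (z : P) (T : Finset (Fin n)) : fc g z T ≤ z :=
  (g.exists_face z T).choose_spec.1

theorem sp_fc (g : Good x) (z : P) (T : Finset (Fin n)) : sp x (fc g z T) = T ∩ sp x z :=
  (g.exists_face z T).choose_spec.2

theorem fc_eq (g : Good x) {y z : P} {T : Finset (Fin n)} (h : y ≤ z) (hs : sp x y = T ∩ sp x z) :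
    fc g z T = y := g.eq_of_sp (fc_le g z T) h ((sp_fc g z T).trans hs.symm)

theorem sp_bot (g : Good x) : sp x (⊥ : P) = ∅ := by
  ext i
  simp only [mem_sp, le_bot_iff, Finset.notMem_empty, iff_false]
  exact (g.hatom i).1

theorem sp_atom (g : Good x) (i : Fin n) : sp x (x i) = {i} := by
  ext l
  rw [mem_sp, Finset.mem_singleton, (g.hatom i).le_iff]
  constructor
  · rintro (h | h)
    · exact absurd h (g.hatom l).1
    · exact g.hinj h
  · rintro rfl; exact Or.inr rfl

theorem sp_eq_empty (g : Good x) {z : P} : sp x z = ∅ ↔ z = ⊥ := by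
  constructor
  · intro h
    exact g.eq_of_sp le_rfl bot_le (h.trans (sp_bot g).symm)
  · rintro rfl; exact sp_bot g

end Combin

section Ring
variable {P k n x}

theorem fv_bot : fv P k ⊥ = 1 := by
  rw [fv, ← sub_eq_zero, ← map_one (Ideal.Quotient.mk (faceIdeal P k)), ← map_sub,
    Ideal.Quotient.eq_zero_iff_mem]
  exact Ideal.subset_span (Or.inr rfl)

theorem fv_mul_zero {w y : P} (h : upperBounds {w, y} = ∅) : fv P k w * fv P k y = 0 := by
  rw [fv, fv, ← map_mul, Ideal.Quotient.eq_zero_iff_mem]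
  exact Ideal.subset_span (Or.inl (Or.inl ⟨w, y, h, rfl⟩))

theorem fv_mul {w y m : P} (h : (upperBounds {w, y}).Nonempty) (hm : IsGLB {w, y} m) :
    fv P k w * fv P k y = fv P k m * ∑ z ∈ (Set.toFinite (MUB w y)).toFinset, fv P k z := by
  rw [← sub_eq_zero]
  simp only [fv]
  rw [← map_sum, ← map_mul, ← map_mul, ← map_sub, Ideal.Quotient.eq_zero_iff_mem]
  exact Ideal.subset_span (Or.inl (Or.inr ⟨w, y, m, h, hm, rfl⟩))

theorem mem_ub {w y u : P} : u ∈ upperBounds ({w, y} : Set P) ↔ w ≤ u ∧ y ≤ u := by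
  simp [upperBounds]

theorem mub_eq (g : Good x) {w y z u : P} (hz : z ∈ MUB w y) (hzu : z ≤ u) :
    z = fc g u (sp x w ∪ sp x y) := by
  obtain ⟨h1, h2⟩ := hz
  have h3 := mem_ub.1 h1
  have hs : sp x (fc g u (sp x w ∪ sp x y)) = sp x w ∪ sp x y := by
    rw [sp_fc, Finset.inter_eq_left]
    exact Finset.union_subset (sp_mono (h3.1.trans hzu)) (sp_mono (h3.2.trans hzu))
  symm
  apply h2
  · rw [mem_ub]
    exact ⟨g.le_of_sp (h3.1.trans hzu) (fc_le _ _ _) (by rw [hs]; exact Finset.subset_union_left),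
      g.le_of_sp (h3.2.trans hzu) (fc_le _ _ _) (by rw [hs]; exact Finset.subset_union_right)⟩
  · apply g.le_of_sp (fc_le _ _ _) hzu
    rw [hs]
    exact Finset.union_subset (sp_mono h3.1) (sp_mono h3.2)

theorem fc_mem_mub (g : Good x) {w y u : P} (hw : w ≤ u) (hy : y ≤ u) :
    fc g u (sp x w ∪ sp x y) ∈ MUB w y := by
  have hs : sp x (fc g u (sp x w ∪ sp x y)) = sp x w ∪ sp x y := by
    rw [sp_fc, Finset.inter_eq_left]
    exact Finset.union_subset (sp_mono hw) (sp_mono hy)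
  refine ⟨?_, ?_⟩
  · rw [mem_ub]
    exact ⟨g.le_of_sp hw (fc_le _ _ _) (by rw [hs]; exact Finset.subset_union_left),
      g.le_of_sp hy (fc_le _ _ _) (by rw [hs]; exact Finset.subset_union_right)⟩
  · intro z' hz' hle
    refine le_antisymm hle ?_
    have h3 := mem_ub.1 hz'
    refine g.le_of_sp le_rfl hle ?_
    rw [hs]
    exact Finset.union_subset (sp_mono h3.1) (sp_mono h3.2)

/-- evaluation at the face `F` -/
def evP (F : P) : MvPolynomial P k →ₐ[k] k := aeval fun y => if y ≤ F then (1 : k) else 0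

theorem evP_ideal (g : Good x) (F : P) : ∀ a ∈ faceIdeal P k, evP (k := k) F a = 0 := by
  intro a ha
  have : faceIdeal P k ≤ RingHom.ker (evP (k := k) F) := by
    rw [faceIdeal, Ideal.span_le]
    rintro f ((⟨w, y, h, rfl⟩ | ⟨w, y, m, h, hm, rfl⟩) | rfl)
    · simp only [evP, SetLike.mem_coe, RingHom.mem_ker, map_mul, aeval_X]
      by_cases hw : w ≤ F
      · by_cases hy : y ≤ F
        · exfalso
          have : F ∈ upperBounds ({w, y} : Set P) := mem_ub.2 ⟨hw, hy⟩
          rw [h] at this; exact this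
        · simp [hy]
      · simp [hw]
    · simp only [evP, SetLike.mem_coe, RingHom.mem_ker, map_mul, map_sub, map_sum, aeval_X]
      by_cases hwy : w ≤ F ∧ y ≤ F
      · obtain ⟨hw, hy⟩ := hwy
        have hmF : m ≤ F := (hm.1 (by simp)).trans hw
        rw [Finset.sum_eq_single (fc g F (sp x w ∪ sp x y))]
        · simp [hw, hy, hmF, fc_le]
        · intro b hb hne
          rw [if_neg]
          intro hbF
          exact hne (mub_eq g ((Set.Finite.mem_toFinset _).1 hb) hbF)
        · intro hn
          exact absurd ((Set.Finite.mem_toFinset _).2 (fc_mem_mub g hw hy)) hn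
      · rw [Finset.sum_eq_zero]
        · by_cases hw : w ≤ F
          · have hy : ¬ y ≤ F := fun h => hwy ⟨hw, h⟩
            simp [hy]
          · simp [hw]
        · intro z hz
          rw [if_neg]
          intro hzF
          have h3 := mem_ub.1 ((Set.Finite.mem_toFinset _).1 hz).1
          exact hwy ⟨h3.1.trans hzF, h3.2.trans hzF⟩
    · simp [evP, RingHom.mem_ker]
  exact this ha

/-- evaluation at the face `F` -/
def ev (k : Type) [Field k] (g : Good x) (F : P) : FaceRing P k →ₐ[k] k :=
  Ideal.Quotient.liftₐ (faceIdeal P k) (evP F) (evP_ideal g F)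

theorem ev_fv (g : Good x) (F y : P) : ev k g F (fv P k y) = if y ≤ F then 1 else 0 := by
  rw [ev, fv]
  erw [Ideal.Quotient.lift_mk]
  simp [evP]

theorem ev_mon (g : Good x) (F : P) (σ : P →₀ ℕ) :
    ev k g F (Ideal.Quotient.mk _ (monomial σ (1 : k))) =
      if ∀ y ∈ σ.support, y ≤ F then 1 else 0 := by
  rw [ev]
  erw [Ideal.Quotient.lift_mk]
  simp only [evP, AlgHom.coe_toRingHom, aeval_monomial, map_one, one_mul, Finsupp.prod]
  split_ifs with h
  · apply Finset.prod_eq_one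
    intro y hy
    simp [h y hy]
  · push Not at h
    obtain ⟨y, hy, hyF⟩ := h
    apply Finset.prod_eq_zero hy
    rw [if_neg hyF, zero_pow]
    exact Finsupp.mem_support_iff.1 hy

theorem glb_exists (g : Good x) {w y u : P} (hw : w ≤ u) (hy : y ≤ u) :
    IsGLB {w, y} (fc g u (sp x w ∩ sp x y)) := by
  have hs : sp x (fc g u (sp x w ∩ sp x y)) = sp x w ∩ sp x y := by
    rw [sp_fc, Finset.inter_eq_left]
    exact Finset.inter_subset_left.trans (sp_mono hw)
  constructor
  · rintro b (rfl | rfl)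
    · exact g.le_of_sp (fc_le _ _ _) hw (by rw [hs]; exact Finset.inter_subset_left)
    · exact g.le_of_sp (fc_le _ _ _) hy (by rw [hs]; exact Finset.inter_subset_right)
  · intro b hb
    have h1 : b ≤ w := hb (by simp)
    have h2 : b ≤ y := hb (by simp)
    refine g.le_of_sp (h1.trans hw) (fc_le _ _ _) ?_
    rw [hs]
    exact Finset.subset_inter (sp_mono h1) (sp_mono h2)

theorem fc_mul (g : Good x) (z : P) (T : Finset (Fin n)) (hT : T ⊆ sp x z) :
    fv P k (fc g z T) * fv P k z = (∏ i ∈ T, fv P k (x i)) * fv P k z := by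
  induction T using Finset.induction_on with
  | empty =>
    have : fc g z ∅ = ⊥ := fc_eq g bot_le (by rw [sp_bot g]; simp)
    rw [this, fv_bot]; simp
  | insert i T hi ih =>
    have hiz : i ∈ sp x z := hT (by simp)
    have hTz : T ⊆ sp x z := (Finset.subset_insert _ _).trans hT
    have hsT : sp x (fc g z T) = T := by rw [sp_fc, Finset.inter_eq_left]; exact hTz
    have hxz : x i ≤ z := mem_sp.1 hiz
    rw [Finset.prod_insert hi, mul_assoc, ← ih hTz, ← mul_assoc]
    have hglb : IsGLB {x i, fc g z T} (⊥ : P) := by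
      have := glb_exists g hxz (fc_le g z T)
      convert this using 1
      symm
      apply fc_eq g bot_le
      rw [sp_bot g, sp_atom g, hsT, Finset.singleton_inter_of_notMem hi]
      simp
    rw [fv_mul ⟨z, mem_ub.2 ⟨hxz, fc_le _ _ _⟩⟩ hglb, fv_bot, one_mul, Finset.sum_mul]
    have hun : insert i T = sp x (x i) ∪ sp x (fc g z T) := by
      rw [sp_atom g, hsT]; rfl
    rw [Finset.sum_eq_single (fc g z (insert i T))]
    · intro b hb hne
      apply fv_mul_zero
      by_contra hcon
      obtain ⟨u, hu⟩ := Set.nonempty_iff_ne_empty.2 hcon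
      obtain ⟨hbu, hzu⟩ := mem_ub.1 hu
      apply hne
      have h1 := mub_eq g ((Set.Finite.mem_toFinset _).1 hb) hbu
      rw [h1, ← hun]
      apply fc_eq g ((fc_le _ _ _).trans hzu)
      rw [sp_fc, Finset.inter_eq_left.2 hT, Finset.inter_eq_left.2 (hT.trans (sp_mono hzu))]
    · intro hn
      refine absurd ((Set.Finite.mem_toFinset _).2 ?_) hn
      rw [hun]
      exact fc_mem_mub g hxz (fc_le _ _ _)

/-- normal-form monomials -/
def mon (k : Type) [Field k] (x : Fin n → P) (F : P) (a : Fin n → ℕ) : FaceRing P k :=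
  fv P k F * ∏ i, fv P k (x i) ^ a i

def MS (k : Type) [Field k] (x : Fin n → P) (β : Fin n → ℤ) : Set (FaceRing P k) :=
  {r | ∃ F a, (∀ i, a i ≠ 0 → x i ≤ F) ∧
    (∀ i, (a i : ℤ) + (if x i ≤ F then 1 else 0) = β i) ∧ r = mon k x F a}

theorem MS_mul (g : Good x) {β β' : Fin n → ℤ} {r r' : FaceRing P k}
    (h : r ∈ Submodule.span k (MS k x β)) (h' : r' ∈ Submodule.span k (MS k x β')) :
    r * r' ∈ Submodule.span k (MS k x (β + β')) := by
  have := Submodule.mul_mem_mul h h'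
  rw [Submodule.span_mul_span] at this
  refine (Submodule.span_le.2 ?_) this
  rintro _ ⟨_, ⟨F, a, h1, h2, rfl⟩, _, ⟨F', a', h1', h2', rfl⟩, rfl⟩
  simp only [SetLike.mem_coe]
  have e1 : mon k x F a * mon k x F' a' =
      (fv P k F * fv P k F') * ∏ i, fv P k (x i) ^ (a i + a' i) := by
    simp only [mon, pow_add, Finset.prod_mul_distrib]; ring
  rw [e1]
  by_cases hub : upperBounds {F, F'} = ∅
  · rw [fv_mul_zero hub, zero_mul]; exact zero_mem _
  · obtain ⟨u, hu⟩ := Set.nonempty_iff_ne_empty.2 hub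
    obtain ⟨hFu, hFu'⟩ := mem_ub.1 hu
    rw [fv_mul ⟨u, hu⟩ (glb_exists g hFu hFu'), Finset.mul_sum, Finset.sum_mul]
    apply Submodule.sum_mem
    intro z hz
    have hz' := (Set.Finite.mem_toFinset _).1 hz
    obtain ⟨hFz, hFz'⟩ := mem_ub.1 hz'.1
    have hsub : sp x F ∩ sp x F' ⊆ sp x z := Finset.inter_subset_left.trans (sp_mono hFz)
    have e2 : fc g u (sp x F ∩ sp x F') = fc g z (sp x F ∩ sp x F') :=
      (glb_exists g hFu hFu').unique (glb_exists g hFz hFz')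
    rw [e2, fc_mul g z _ hsub]
    have hsz : sp x z = sp x F ∪ sp x F' := by
      have := mub_eq g hz' le_rfl
      have h3 := sp_fc g z (sp x F ∪ sp x F')
      rw [← this] at h3
      rw [h3, Finset.inter_eq_left]
      exact Finset.union_subset (sp_mono hFz) (sp_mono hFz')
    have hprod : ∏ i ∈ sp x F ∩ sp x F', fv P k (x i) =
        ∏ i, fv P k (x i) ^ (if i ∈ sp x F ∩ sp x F' then 1 else 0) := by
      simp only [pow_ite, pow_one, pow_zero]
      rw [Finset.prod_ite_mem, Finset.univ_inter]
    apply Submodule.subset_span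
    refine ⟨z, fun i => (if i ∈ sp x F ∩ sp x F' then 1 else 0) + (a i + a' i), ?_, ?_, ?_⟩
    · intro i hi
      by_contra hc
      have c1 : ¬ x i ≤ F := fun h => hc (h.trans hFz)
      have c2 : ¬ x i ≤ F' := fun h => hc (h.trans hFz')
      have c3 : a i = 0 := by by_contra h; exact c1 (h1 i h)
      have c4 : a' i = 0 := by by_contra h; exact c2 (h1' i h)
      simp [c3, c4, mem_sp, c1] at hi
    · intro i
      have hzi : x i ≤ z ↔ x i ≤ F ∨ x i ≤ F' := by
        rw [← mem_sp, hsz, Finset.mem_union, mem_sp, mem_sp]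
      simp only [Pi.add_apply, ← h2 i, ← h2' i, Finset.mem_inter, mem_sp, hzi]
      by_cases c1 : x i ≤ F <;> by_cases c2 : x i ≤ F' <;> simp [c1, c2] <;> ring
    · rw [hprod, mon]
      simp only [pow_add, Finset.prod_mul_distrib]; ring

/-- degree of a monomial -/
def fdeg (x : Fin n → P) (σ : P →₀ ℕ) : Fin n → ℤ := fun j =>
  ∑ y ∈ σ.support, if x j ≤ y then (σ y : ℤ) else 0

theorem fdeg_add (σ τ : P →₀ ℕ) : fdeg x (σ + τ) = fdeg x σ + fdeg x τ := by
  funext j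
  have : ∀ σ : P →₀ ℕ, fdeg x σ j = σ.sum fun y c => if x j ≤ y then (c : ℤ) else 0 :=
    fun _ => rfl
  simp only [Pi.add_apply, this]
  rw [Finsupp.sum_add_index']
  · simp
  · intro a b c; split_ifs <;> simp

theorem fdeg_single (y : P) (c : ℕ) :
    fdeg x (Finsupp.single y c) = fun j => if x j ≤ y then (c : ℤ) else 0 := by
  funext j
  have : ∀ σ : P →₀ ℕ, fdeg x σ j = σ.sum fun y c => if x j ≤ y then (c : ℤ) else 0 :=
    fun _ => rfl
  rw [this, Finsupp.sum_single_index (by simp)]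

theorem fdeg_zero : fdeg x (0 : P →₀ ℕ) = 0 := by
  funext j; simp [fdeg]

theorem mon_mem_MS (g : Good x) (σ : P →₀ ℕ) :
    Ideal.Quotient.mk (faceIdeal P k) (monomial σ (1 : k)) ∈
      Submodule.span k (MS k x (fdeg x σ)) := by
  have hadd : ∀ σ τ : P →₀ ℕ,
      Ideal.Quotient.mk (faceIdeal P k) (monomial σ (1 : k)) ∈
        Submodule.span k (MS k x (fdeg x σ)) →
      Ideal.Quotient.mk (faceIdeal P k) (monomial τ (1 : k)) ∈
        Submodule.span k (MS k x (fdeg x τ)) →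
      Ideal.Quotient.mk (faceIdeal P k) (monomial (σ + τ) (1 : k)) ∈
        Submodule.span k (MS k x (fdeg x (σ + τ))) := by
    intro σ τ h1 h2
    have h3 := MS_mul g h1 h2
    rw [← map_mul, monomial_mul, one_mul, ← fdeg_add] at h3
    exact h3
  have hzero : Ideal.Quotient.mk (faceIdeal P k) (monomial 0 (1 : k)) ∈
        Submodule.span k (MS k x (fdeg x 0)) := by
    apply Submodule.subset_span
    refine ⟨⊥, 0, by simp, ?_, ?_⟩
    · intro i
      rw [fdeg_zero, if_neg]
      · simp
      · rw [le_bot_iff]; exact (g.hatom i).1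
    · simp [mon, fv_bot]
  induction σ using Finsupp.induction_linear with
  | zero => exact hzero
  | add σ τ h1 h2 => exact hadd σ τ h1 h2
  | single y b =>
    induction b with
    | zero => rw [Finsupp.single_zero]; exact hzero
    | succ b ih =>
      rw [Finsupp.single_add]
      apply hadd _ _ ih
      apply Submodule.subset_span
      refine ⟨y, 0, by simp, ?_, ?_⟩
      · intro i
        rw [fdeg_single]; simp
      · simp [mon, fv, X]

theorem facePiece_eq_fdeg (β : Fin n → ℤ) : facePiece P k n x β = Submodule.span k
    {r | ∃ σ : P →₀ ℕ, fdeg x σ = β ∧ r = Ideal.Quotient.mk _ (monomial σ (1 : k))} := by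
  rw [facePiece]
  congr 1
  ext r
  constructor
  · rintro ⟨σ, h, rfl⟩; exact ⟨σ, funext h, rfl⟩
  · rintro ⟨σ, h, rfl⟩; exact ⟨σ, fun j => congrFun h j, rfl⟩

theorem facePiece_le (g : Good x) (β : Fin n → ℤ) :
    facePiece P k n x β ≤ Submodule.span k (MS k x β) := by
  rw [facePiece_eq_fdeg, Submodule.span_le]
  rintro _ ⟨σ, rfl, rfl⟩
  exact mon_mem_MS g σ

theorem facePiece_mul {β β' : Fin n → ℤ} {r r' : FaceRing P k}
    (h : r ∈ facePiece P k n x β) (h' : r' ∈ facePiece P k n x β') :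
    r * r' ∈ facePiece P k n x (β + β') := by
  rw [facePiece_eq_fdeg] at *
  have := Submodule.mul_mem_mul h h'
  rw [Submodule.span_mul_span] at this
  refine (Submodule.span_mono ?_) this
  rintro _ ⟨_, ⟨σ, h1, rfl⟩, _, ⟨τ, h2, rfl⟩, rfl⟩
  refine ⟨σ + τ, by rw [fdeg_add, h1, h2], ?_⟩
  simp only
  rw [← map_mul, monomial_mul, one_mul]

theorem fv_mem (y : P) : fv P k y ∈ facePiece P k n x (fun j => if x j ≤ y then 1 else 0) := by
  rw [facePiece_eq_fdeg]
  apply Submodule.subset_span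
  refine ⟨Finsupp.single y 1, by rw [fdeg_single]; simp, rfl⟩

theorem one_mem_facePiece : (1 : FaceRing P k) ∈ facePiece P k n x 0 := by
  rw [facePiece_eq_fdeg]
  apply Submodule.subset_span
  exact ⟨0, fdeg_zero, by simp⟩

theorem fvx_mem (g : Good x) (i : Fin n) : fv P k (x i) ∈ facePiece P k n x (Pi.single i 1) := by
  convert fv_mem (k := k) (x := x) (x i) using 1
  congr 1
  funext j
  rw [← mem_sp, sp_atom g, Finset.mem_singleton, Pi.single_apply]
  split_ifs <;> rfl

theorem fvx_pow_mem (g : Good x) (i : Fin n) (c : ℕ) :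
    fv P k (x i) ^ c ∈ facePiece P k n x (Pi.single i (c : ℤ)) := by
  induction c with
  | zero => simpa using one_mem_facePiece
  | succ c ih =>
    rw [pow_succ]
    have := facePiece_mul ih (fvx_mem g i)
    rw [← Pi.single_add] at this
    simpa using this

theorem prod_mem_facePiece (g : Good x) (a : Fin n → ℕ) (s : Finset (Fin n)) :
    ∏ i ∈ s, fv P k (x i) ^ a i ∈ facePiece P k n x (fun i => if i ∈ s then (a i : ℤ) else 0) := by
  induction s using Finset.induction_on with
  | empty => simp only [Finset.prod_empty, Finset.notMem_empty, if_false]; exact one_mem_facePiece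
  | insert i s hi ih =>
    rw [Finset.prod_insert hi]
    convert facePiece_mul (fvx_pow_mem g i (a i)) ih using 2
    funext l
    by_cases hl : l = i
    · subst hl; simp [hi]
    · simp [hl]

theorem mon_mem (g : Good x) {β : Fin n → ℤ} {F : P} {a : Fin n → ℕ}
    (h : ∀ i, (a i : ℤ) + (if x i ≤ F then 1 else 0) = β i) :
    mon k x F a ∈ facePiece P k n x β := by
  convert facePiece_mul (fv_mem F) (prod_mem_facePiece g a Finset.univ) using 2
  · funext i
    rw [← h i]; simp [add_comm]
  · rfl

theorem facePiece_neg {β : Fin n → ℤ} {i : Fin n} (h : β i < 0) : facePiece P k n x β = ⊥ := by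
  rw [facePiece_eq_fdeg, eq_bot_iff, Submodule.span_le]
  rintro _ ⟨σ, rfl, rfl⟩
  exfalso
  have : 0 ≤ fdeg x σ i := Finset.sum_nonneg fun y _ => by split_ifs <;> simp
  omega

theorem ev_fc (g : Good x) {β : Fin n → ℤ} {F : P} {T : Finset (Fin n)} (hT : T ⊆ sp x F)
    (hβ : ∀ i, i ∉ T → β i = 0) {r : FaceRing P k} (hr : r ∈ facePiece P k n x β) :
    ev k g F r = ev k g (fc g F T) r := by
  rw [facePiece_eq_fdeg] at hr
  induction hr using Submodule.span_induction with
  | zero => simp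
  | add a b _ _ ha hb => rw [map_add, map_add, ha, hb]
  | smul c a _ ha => rw [map_smul, map_smul, ha]
  | mem r hr =>
    obtain ⟨σ, rfl, rfl⟩ := hr
    rw [ev_mon, ev_mon]
    congr 1
    apply propext
    apply forall_congr'
    intro y
    apply forall_congr'
    intro hy
    constructor
    · intro hyF
      apply g.le_of_sp hyF (fc_le _ _ _)
      rw [sp_fc, Finset.inter_eq_left.2 hT]
      intro i hi
      by_contra hiT
      have h0 := hβ i hiT
      rw [fdeg, Finset.sum_eq_zero_iff_of_nonneg (fun y _ => by split_ifs <;> simp)] at h0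
      have := h0 y hy
      rw [if_pos (mem_sp.1 hi)] at this
      exact Finsupp.mem_support_iff.1 hy (by exact_mod_cast this)
    · intro h; exact h.trans (fc_le _ _ _)

theorem ev_monNF (g : Good x) {F F' : P} {a : Fin n → ℕ} (ha : ∀ i, a i ≠ 0 → x i ≤ F)
    (hs : sp x F = sp x F') : ev k g F' (mon k x F a) = if F = F' then 1 else 0 := by
  rw [mon, map_mul, ev_fv, map_prod]
  by_cases h : F = F'
  · subst h
    rw [if_pos le_rfl, if_pos rfl, one_mul]
    apply Finset.prod_eq_one
    intro i _
    rw [map_pow, ev_fv]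
    by_cases h0 : a i = 0
    · simp [h0]
    · simp [ha i h0]
  · rw [if_neg h, if_neg, zero_mul]
    intro hle
    exact h (g.eq_of_sp hle le_rfl hs)

theorem facePiece_expand (g : Good x) {β : Fin n → ℤ} {r : FaceRing P k}
    (hr : r ∈ facePiece P k n x β) :
    r = ∑ F ∈ Finset.univ.filter (fun F : P => ∀ i, x i ≤ F ↔ β i ≠ 0),
      ev k g F r • mon k x F (fun i => (β i - if x i ≤ F then 1 else 0).toNat) := by
  have hr' := facePiece_le g β hr
  clear hr
  induction hr' using Submodule.span_induction with
  | zero => simp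
  | add a b _ _ ha hb =>
    simp only [map_add, add_smul, Finset.sum_add_distrib]
    rw [← ha, ← hb]
  | smul c a _ ha =>
    simp only [map_smul, smul_assoc]
    rw [← Finset.smul_sum, ← ha]
  | mem r hr =>
    obtain ⟨F, a, h1, h2, rfl⟩ := hr
    have hF : ∀ i, x i ≤ F ↔ β i ≠ 0 := by
      intro i
      rw [← h2 i]
      by_cases h : x i ≤ F
      · simp [h]; omega
      · have : a i = 0 := by by_contra h'; exact h (h1 i h')
        simp [h, this]
    rw [Finset.sum_eq_single F]
    · rw [ev_monNF g h1 rfl, if_pos rfl, one_smul]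
      congr 1
      funext i
      rw [← h2 i]; simp
    · intro F' hF' hne
      rw [ev_monNF g h1, if_neg hne.symm, zero_smul]
      ext i
      rw [mem_sp, mem_sp, hF i, (Finset.mem_filter.1 hF').2 i]
    · intro hn
      exact absurd (Finset.mem_filter.2 ⟨Finset.mem_univ _, hF⟩) hn

theorem facePiece_inj (g : Good x) {β : Fin n → ℤ} {r : FaceRing P k}
    (hr : r ∈ facePiece P k n x β) (h : ∀ F : P, (∀ i, x i ≤ F ↔ β i ≠ 0) → ev k g F r = 0) :
    r = 0 := by
  rw [facePiece_expand g hr]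
  apply Finset.sum_eq_zero
  intro F hF
  rw [h F (Finset.mem_filter.1 hF).2, zero_smul]

end Ring

section Carrier

/-- linear extension of a function on basis elements -/
abbrev lx {k : Type} [Field k] {B M : Type} [AddCommGroup M] [Module k M] (v : B → M) :
    (B →₀ k) →ₗ[k] M := Finsupp.linearCombination k v

theorem lx_mem {k : Type} [Field k] {B M : Type} [AddCommGroup M] [Module k M] {v : B → M}
    {S : Set B} {N : Submodule k M} (h : ∀ b ∈ S, v b ∈ N) {c : B →₀ k}
    (hc : c ∈ Finsupp.supported k k S) : lx v c ∈ N := by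
  rw [Finsupp.linearCombination_apply]
  apply Submodule.sum_mem
  intro b hb
  exact N.smul_mem _ (h b (hc hb))

theorem lx_congr {k : Type} [Field k] {B M : Type} [AddCommGroup M] [Module k M]
    {f f' : (B →₀ k) →ₗ[k] M}
    {S : Set B} (h : ∀ b ∈ S, f (Finsupp.single b 1) = f' (Finsupp.single b 1)) {c : B →₀ k}
    (hc : c ∈ Finsupp.supported k k S) : f c = f' c := by
  rw [Finsupp.supported_eq_span_single] at hc
  induction hc using Submodule.span_induction with
  | zero => simp
  | add a b _ _ ha hb => rw [map_add, map_add, ha, hb]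
  | smul c a _ ha => rw [map_smul, map_smul, ha]
  | mem r hr => obtain ⟨b, hb, rfl⟩ := hr; exact h b hb

/-- A based chain complex with carriers in a poset `P`, with contractions of the
subcomplexes carried by `z ≠ ⊥`. -/
structure CC (P : Type) [PartialOrder P] [OrderBot P] (k : Type) [Field k] where
  B : Type
  car : B → P
  deg : B → ℕ
  bd : B → (B →₀ k)
  bot : B
  κ : P → B → (B →₀ k)
  bd_mem : ∀ b, bd b ∈ Finsupp.supported k k {b' | car b' ≤ car b ∧ deg b' + 1 = deg b}
  bd_bd : ∀ b, lx bd (bd b) = 0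
  car_bot : ∀ b, car b = ⊥ → b = bot
  deg_bot : deg bot = 0
  deg_zero : ∀ b, deg b = 0 → b = bot
  κ_mem : ∀ z b, car b ≤ z → κ z b ∈ Finsupp.supported k k {b' | car b' ≤ z ∧ deg b' = deg b + 1}
  κ_id : ∀ z b, z ≠ ⊥ → car b ≤ z → lx bd (κ z b) + lx (κ z) (bd b) = Finsupp.single b 1

variable {P : Type} [PartialOrder P] [OrderBot P] {k : Type} [Field k]

namespace CC

def sup (C : CC P k) (z : P) (d : ℕ) : Submodule k (C.B →₀ k) :=
  Finsupp.supported k k {b' | C.car b' ≤ z ∧ C.deg b' = d}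

theorem bd_mem' (C : CC P k) {b : C.B} {d : ℕ} (h : C.deg b = d + 1) :
    C.bd b ∈ C.sup (C.car b) d := by
  refine Finsupp.supported_mono ?_ (C.bd_mem b)
  rintro b' ⟨h1, h2⟩
  exact ⟨h1, by omega⟩

theorem bd_zero (C : CC P k) {b : C.B} (h : C.deg b = 0) : C.bd b = 0 := by
  have := C.bd_mem b
  have h0 : {b' | C.car b' ≤ C.car b ∧ C.deg b' + 1 = C.deg b} = ∅ := by
    ext b'; simp [h]
  rw [h0, Finsupp.supported_empty] at this
  simpa using this

theorem sup_mono (C : CC P k) {z z' : P} (h : z ≤ z') (d : ℕ) : C.sup z d ≤ C.sup z' d :=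
  Finsupp.supported_mono fun _ hb => ⟨hb.1.trans h, hb.2⟩

theorem single_mem (C : CC P k) (b : C.B) : Finsupp.single b (1 : k) ∈ C.sup (C.car b) (C.deg b) :=
  Finsupp.single_mem_supported k 1 ⟨le_rfl, rfl⟩

/-- the boundary operator -/
def dd (C : CC P k) : (C.B →₀ k) →ₗ[k] (C.B →₀ k) := lx C.bd

theorem dd_single (C : CC P k) (b : C.B) : C.dd (Finsupp.single b 1) = C.bd b := by
  simp [dd, lx]

theorem dd_dd (C : CC P k) (c : C.B →₀ k) : C.dd (C.dd c) = 0 := by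
  have : C.dd.comp C.dd = 0 := by
    apply Finsupp.lhom_ext'
    intro b
    apply LinearMap.ext_ring
    simp only [LinearMap.comp_apply, Finsupp.lsingle_apply, dd_single]
    exact C.bd_bd b
  exact LinearMap.congr_fun this c

theorem dd_mem (C : CC P k) {z : P} {d : ℕ} {c : C.B →₀ k} (h : c ∈ C.sup z (d + 1)) :
    C.dd c ∈ C.sup z d :=
  lx_mem (fun _ hb => C.sup_mono hb.1 d (C.bd_mem' hb.2)) h

theorem kk_mem (C : CC P k) {z : P} {d : ℕ} {c : C.B →₀ k} (h : c ∈ C.sup z d) :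
    lx (C.κ z) c ∈ C.sup z (d + 1) :=
  lx_mem (fun b hb => by
    have := C.κ_mem z b hb.1
    rw [hb.2] at this; exact this) h

theorem kk_id (C : CC P k) {z : P} (hz : z ≠ ⊥) {d : ℕ} {c : C.B →₀ k} (h : c ∈ C.sup z d) :
    C.dd (lx (C.κ z) c) + lx (C.κ z) (C.dd c) = c := by
  have : (C.dd.comp (lx (C.κ z)) + (lx (C.κ z)).comp C.dd) c = (LinearMap.id : (C.B →₀ k) →ₗ[k] _) c := by
    apply lx_congr (S := {b' | C.car b' ≤ z ∧ C.deg b' = d}) _ h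
    intro b hb
    have := C.κ_id z b hz hb.1
    simpa [dd, lx] using this
  simpa using this

theorem car_ne_bot (C : CC P k) {b : C.B} {d : ℕ} (h : C.deg b = d + 1) : C.car b ≠ ⊥ := by
  intro h0
  have := C.car_bot b h0
  rw [this, C.deg_bot] at h
  omega

/-- chain maps, carried, preserving the augmentation -/
structure IsCM (C C' : CC P k) (f : (C.B →₀ k) →ₗ[k] (C'.B →₀ k)) : Prop where
  mem : ∀ b, f (Finsupp.single b 1) ∈ C'.sup (C.car b) (C.deg b)
  comm : ∀ c, C'.dd (f c) = f (C.dd c)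
  bot : f (Finsupp.single C.bot 1) = Finsupp.single C'.bot 1

theorem IsCM.mem' {C C' : CC P k} {f : (C.B →₀ k) →ₗ[k] (C'.B →₀ k)} (h : IsCM C C' f)
    {z : P} {d : ℕ} {c : C.B →₀ k} (hc : c ∈ C.sup z d) : f c ∈ C'.sup z d := by
  have hf : f = lx fun b => f (Finsupp.single b 1) := by
    apply Finsupp.lhom_ext'
    intro b; ext; simp [lx]
  rw [hf]
  refine lx_mem (fun b hb => ?_) hc
  have := C'.sup_mono hb.1 _ (h.mem b)
  rw [hb.2] at this
  exact this

theorem IsCM.id (C : CC P k) : IsCM C C LinearMap.id :=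
  ⟨fun b => C.single_mem b, fun _ => rfl, rfl⟩

theorem IsCM.comp {C C' C'' : CC P k} {f : (C.B →₀ k) →ₗ[k] (C'.B →₀ k)}
    {f' : (C'.B →₀ k) →ₗ[k] (C''.B →₀ k)} (h' : IsCM C' C'' f') (h : IsCM C C' f) :
    IsCM C C'' (f'.comp f) :=
  ⟨fun b => h'.mem' (h.mem b), fun c => by simp [h'.comm, h.comm], by simp [h.bot, h'.bot]⟩

/-- recursive construction of a chain map -/
def cmAux (C C' : CC P k) : ℕ → C.B → (C'.B →₀ k)
  | 0 => fun _ => Finsupp.single C'.bot 1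
  | d + 1 => fun b => lx (C'.κ (C.car b)) (lx (cmAux C C' d) (C.bd b))

def cm (C C' : CC P k) : (C.B →₀ k) →ₗ[k] (C'.B →₀ k) := lx fun b => cmAux C C' (C.deg b) b

theorem cm_single (C C' : CC P k) (b : C.B) :
    cm C C' (Finsupp.single b 1) = cmAux C C' (C.deg b) b := by simp [cm, lx]

theorem cm_succ (C C' : CC P k) {b : C.B} {d : ℕ} (h : C.deg b = d + 1) :
    cm C C' (Finsupp.single b 1) = lx (C'.κ (C.car b)) (cm C C' (C.bd b)) := by
  have e : lx (cmAux C C' d) (C.bd b) = cm C C' (C.bd b) := by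
    refine lx_congr (S := {b' | C.car b' ≤ C.car b ∧ C.deg b' = d}) ?_ (C.bd_mem' h)
    intro b' hb'
    rw [cm_single, hb'.2]; simp [lx]
  rw [cm_single, h, ← e]
  rfl

theorem cm_main (C C' : CC P k) (hbot : C'.car C'.bot = ⊥) : ∀ (d : ℕ) (b : C.B), C.deg b = d →
    cm C C' (Finsupp.single b 1) ∈ C'.sup (C.car b) d ∧
    C'.dd (cm C C' (Finsupp.single b 1)) = cm C C' (C.bd b) := by
  intro d
  induction d with
  | zero =>
    intro b hb
    rw [cm_single, hb, C.bd_zero hb, cmAux, dd_single, C'.bd_zero C'.deg_bot]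
    refine ⟨?_, by simp⟩
    have := C'.single_mem C'.bot
    rw [C'.deg_bot] at this
    exact C'.sup_mono (by rw [hbot]; exact bot_le) _ this
  | succ d ih =>
    intro b hb
    have hm : ∀ c ∈ C.sup (C.car b) d, cm C C' c ∈ C'.sup (C.car b) d := by
      intro c hc
      refine lx_mem (fun b' hb' => ?_) hc
      rw [← cm_single]
      exact C'.sup_mono hb'.1 _ (ih b' hb'.2).1
    have hc : ∀ c ∈ C.sup (C.car b) d, C'.dd (cm C C' c) = cm C C' (C.dd c) := by
      intro c hc
      have : (C'.dd.comp (cm C C')) c = ((cm C C').comp C.dd) c := by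
        refine lx_congr (fun b' hb' => ?_) hc
        simp only [LinearMap.comp_apply, dd_single]
        exact (ih b' hb'.2).2
      exact this
    have h1 := hm _ (C.bd_mem' hb)
    rw [cm_succ C C' hb]
    refine ⟨C'.kk_mem h1, ?_⟩
    have h2 := C'.kk_id (C.car_ne_bot hb) h1
    rw [hc _ (C.bd_mem' hb)] at h2
    have h3 : C.dd (C.bd b) = 0 := C.bd_bd b
    rw [h3] at h2
    simpa using h2

theorem cm_isCM (C C' : CC P k) (hbot : C'.car C'.bot = ⊥) : IsCM C C' (cm C C') where
  mem b := (cm_main C C' hbot _ b rfl).1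
  comm c := by
    have : C'.dd.comp (cm C C') = (cm C C').comp C.dd := by
      apply Finsupp.lhom_ext'
      intro b
      apply LinearMap.ext_ring
      simp only [LinearMap.comp_apply, Finsupp.lsingle_apply, dd_single]
      exact (cm_main C C' hbot _ b rfl).2
    exact LinearMap.congr_fun this c
  bot := by rw [cm_single, C.deg_bot]; rfl

/-- recursive construction of a homotopy -/
def htAux (C C' : CC P k) (f : (C.B →₀ k) →ₗ[k] (C'.B →₀ k)) : ℕ → C.B → (C'.B →₀ k)
  | 0 => fun _ => 0
  | d + 1 => fun b => lx (C'.κ (C.car b))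
      (f (Finsupp.single b 1) - lx (htAux C C' f d) (C.bd b))

def ht (C C' : CC P k) (f : (C.B →₀ k) →ₗ[k] (C'.B →₀ k)) : (C.B →₀ k) →ₗ[k] (C'.B →₀ k) :=
  lx fun b => htAux C C' f (C.deg b) b

theorem ht_single (C C' : CC P k) (f : (C.B →₀ k) →ₗ[k] (C'.B →₀ k)) (b : C.B) :
    ht C C' f (Finsupp.single b 1) = htAux C C' f (C.deg b) b := by simp [ht, lx]

theorem ht_succ (C C' : CC P k) (f : (C.B →₀ k) →ₗ[k] (C'.B →₀ k)) {b : C.B} {d : ℕ}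
    (h : C.deg b = d + 1) :
    ht C C' f (Finsupp.single b 1) =
      lx (C'.κ (C.car b)) (f (Finsupp.single b 1) - ht C C' f (C.bd b)) := by
  have e : lx (htAux C C' f d) (C.bd b) = ht C C' f (C.bd b) := by
    refine lx_congr (S := {b' | C.car b' ≤ C.car b ∧ C.deg b' = d}) ?_ (C.bd_mem' h)
    intro b' hb'
    rw [ht_single, hb'.2]; simp [lx]
  rw [ht_single, h, ← e]
  rfl

/-- If `f` is the difference of two chain maps, it is null-homotopic. -/
theorem ht_main (C C' : CC P k) (f : (C.B →₀ k) →ₗ[k] (C'.B →₀ k))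
    (hmem : ∀ b, f (Finsupp.single b 1) ∈ C'.sup (C.car b) (C.deg b))
    (hcomm : ∀ c, C'.dd (f c) = f (C.dd c)) (hbot : f (Finsupp.single C.bot 1) = 0) :
    ∀ (d : ℕ) (b : C.B), C.deg b = d →
    ht C C' f (Finsupp.single b 1) ∈ C'.sup (C.car b) (d + 1) ∧
    C'.dd (ht C C' f (Finsupp.single b 1)) + ht C C' f (C.bd b) = f (Finsupp.single b 1) := by
  intro d
  induction d with
  | zero =>
    intro b hb
    rw [ht_single, hb, C.bd_zero hb, htAux]
    refine ⟨zero_mem _, ?_⟩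
    rw [C.deg_zero b hb, hbot]; simp
  | succ d ih =>
    intro b hb
    have hm : ∀ c ∈ C.sup (C.car b) d, ht C C' f c ∈ C'.sup (C.car b) (d + 1) := by
      intro c hc
      refine lx_mem (fun b' hb' => ?_) hc
      rw [← ht_single]
      exact C'.sup_mono hb'.1 _ (ih b' hb'.2).1
    have hc : ∀ c ∈ C.sup (C.car b) d, C'.dd (ht C C' f c) + ht C C' f (C.dd c) = f c := by
      intro c hc
      have : (C'.dd.comp (ht C C' f) + (ht C C' f).comp C.dd) c = f c := by
        refine lx_congr (fun b' hb' => ?_) hc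
        simp only [LinearMap.add_apply, LinearMap.comp_apply, dd_single]
        exact (ih b' hb'.2).2
      exact this
    have h0 := hmem b
    rw [hb] at h0
    have h1 := Submodule.sub_mem _ h0 (hm _ (C.bd_mem' hb))
    rw [ht_succ C C' f hb]
    refine ⟨C'.kk_mem h1, ?_⟩
    have h2 := C'.kk_id (C.car_ne_bot hb) h1
    have h3 : C.dd (C.bd b) = 0 := C.bd_bd b
    have h4 := hc _ (C.bd_mem' hb)
    rw [h3, map_zero, add_zero] at h4
    rw [map_sub C'.dd, hcomm, dd_single, h4, sub_self, map_zero, add_zero] at h2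
    rw [h2]; abel

/-- The homotopy with its properties. -/
theorem exists_ht {C C' : CC P k} {f f' : (C.B →₀ k) →ₗ[k] (C'.B →₀ k)} (h : IsCM C C' f)
    (h' : IsCM C C' f') : ∃ H : (C.B →₀ k) →ₗ[k] (C'.B →₀ k),
    (∀ b, H (Finsupp.single b 1) ∈ C'.sup (C.car b) (C.deg b + 1)) ∧
    ∀ b, C'.dd (H (Finsupp.single b 1)) + H (C.bd b) =
      f (Finsupp.single b 1) - f' (Finsupp.single b 1) := by
  have := ht_main C C' (f - f') (fun b => Submodule.sub_mem _ (h.mem b) (h'.mem b))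
    (fun c => by simp [h.comm, h'.comm]) (by simp [h.bot, h'.bot])
  exact ⟨ht C C' (f - f'), fun b => (this _ b rfl).1, fun b => (this _ b rfl).2⟩

end CC

end Carrier

section Instances

theorem sign_cancel {ι M k : Type} [Field k] [AddCommGroup M] [Module k M] [DecidableEq ι]
    (r : ι → ι → Prop) [DecidableRel r] (s : Finset ι)
    (tri : ∀ u ∈ s, ∀ v ∈ s, u ≠ v → (r u v ↔ ¬ r v u)) (F : ι → ι → M)
    (hF : ∀ u ∈ s, ∀ v ∈ s, F u v = F v u) :
    ∑ v ∈ s, ((-1 : k) ^ (s.filter fun u => r u v).card) •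
      ∑ u ∈ s.erase v, ((-1 : k) ^ ((s.erase v).filter fun l => r l u).card) • F v u = 0 := by
  have key : ∀ u ∈ s, ∀ v ∈ s, (s.filter fun l => r l u).card =
      ((s.erase v).filter fun l => r l u).card + if r v u then 1 else 0 := by
    intro u hu v hv
    rw [Finset.filter_erase]
    split_ifs with h
    · rw [Finset.card_erase_add_one]
      exact Finset.mem_filter.2 ⟨hv, h⟩
    · rw [Finset.erase_eq_of_notMem]
      · simp
      · intro h'; exact h (Finset.mem_filter.1 h').2
  simp only [Finset.smul_sum, smul_smul]
  rw [Finset.sum_sigma' s (fun v => s.erase v)]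
  apply Finset.sum_involution (fun a _ => ⟨a.2, a.1⟩)
  · rintro ⟨v, u⟩ h
    obtain ⟨hv, hu⟩ := Finset.mem_sigma.1 h
    obtain ⟨huv, hu⟩ := Finset.mem_erase.1 hu
    simp only at hv hu huv ⊢
    rw [hF u hu v hv, ← add_smul]
    convert zero_smul k _
    rw [key u hu v hv, key v hv u hu]
    have := tri u hu v hv huv
    by_cases h1 : r u v
    · have h2 : ¬ r v u := this.1 h1
      simp only [h1, h2, if_true, if_false]
      ring
    · have h2 : r v u := by by_contra h2; exact h1 (this.2 h2)
      simp only [h1, h2, if_true, if_false]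
      ring
  · rintro ⟨v, u⟩ h _ heq
    obtain ⟨hv, hu⟩ := Finset.mem_sigma.1 h
    obtain ⟨huv, hu⟩ := Finset.mem_erase.1 hu
    simp only [Sigma.mk.injEq] at heq
    exact huv heq.1
  · rintro ⟨v, u⟩ _; rfl
  · rintro ⟨v, u⟩ h
    obtain ⟨hv, hu⟩ := Finset.mem_sigma.1 h
    obtain ⟨huv, hu⟩ := Finset.mem_erase.1 hu
    exact Finset.mem_sigma.2 ⟨hu, Finset.mem_erase.2 ⟨huv.symm, hv⟩⟩

variable {P n x}

/-! cellular complex -/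

/-- remove a vertex from a face -/
def rm (g : Good x) (z : P) (i : Fin n) : P := fc g z ((sp x z).erase i)

theorem sp_rm (g : Good x) (z : P) (i : Fin n) : sp x (rm g z i) = (sp x z).erase i := by
  rw [rm, sp_fc, Finset.inter_eq_left]; exact Finset.erase_subset _ _

theorem rm_le (g : Good x) (z : P) (i : Fin n) : rm g z i ≤ z := fc_le _ _ _

def bdD (g : Good x) (z : P) : P →₀ k :=
  ∑ i ∈ sp x z, ((-1 : k) ^ ((sp x z).filter fun l => l < i).card) • Finsupp.single (rm g z i) 1

def kD (g : Good x) (z y : P) : P →₀ k :=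
  if h : (sp x z).Nonempty then
    if (sp x z).min' h ∈ sp x y then 0
    else Finsupp.single (fc g z (insert ((sp x z).min' h) (sp x y))) 1
  else 0

theorem rm_comm (g : Good x) (z : P) (i l : Fin n) : rm g (rm g z i) l = rm g (rm g z l) i := by
  apply g.eq_of_sp ((rm_le _ _ _).trans (rm_le _ _ _)) ((rm_le _ _ _).trans (rm_le _ _ _))
  simp only [sp_rm]
  exact Finset.erase_right_comm

theorem bdbdD (g : Good x) (z : P) : lx (bdD k g) (bdD k g z) = 0 := by
  have h := sign_cancel (k := k) (fun u v : Fin n => u < v) (sp x z)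
    (fun u _ v _ huv => by constructor <;> intro h <;> omega)
    (fun v u => Finsupp.single (rm g (rm g z v) u) (1 : k)) (fun u _ v _ => by rw [rm_comm])
  rw [← h]
  conv_lhs => rw [bdD, map_sum]
  apply Finset.sum_congr rfl
  intro v hv
  rw [map_smul, lx, Finsupp.linearCombination_single, one_smul, bdD, sp_rm]

theorem kD_id (g : Good x) (z y : P) (hz : z ≠ ⊥) (hy : y ≤ z) :
    lx (bdD k g) (kD k g z y) + lx (kD k g z) (bdD k g y) = Finsupp.single y 1 := by
  have hne : (sp x z).Nonempty := by
    rw [Finset.nonempty_iff_ne_empty]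
    exact fun h => hz ((sp_eq_empty g).1 h)
  set a := (sp x z).min' hne with ha
  have haz : a ∈ sp x z := Finset.min'_mem _ _
  have hmin : ∀ i ∈ sp x z, a ≤ i := fun i hi => Finset.min'_le _ _ hi
  have hk : ∀ y', kD k g z y' = if a ∈ sp x y' then 0
      else Finsupp.single (fc g z (insert a (sp x y'))) 1 := by
    intro y'; rw [kD, dif_pos hne]
  have hbd : lx (kD k g z) (bdD k g y) = ∑ i ∈ sp x y,
      ((-1 : k) ^ ((sp x y).filter fun l => l < i).card) • kD k g z (rm g y i) := by
    conv_lhs => rw [bdD, map_sum]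
    apply Finset.sum_congr rfl
    intro v hv
    rw [map_smul, lx, Finsupp.linearCombination_single, one_smul]
  rw [hbd]
  by_cases hay : a ∈ sp x y
  · rw [hk y, if_pos hay, map_zero, zero_add, Finset.sum_eq_single a]
    · have h1 : (sp x y).filter (fun l => l < a) = ∅ := by
        rw [Finset.filter_eq_empty_iff]
        intro l hl
        exact not_lt.2 (hmin l (sp_mono hy hl))
      rw [h1, hk, sp_rm, if_neg (Finset.notMem_erase _ _), Finset.insert_erase hay]
      rw [fc_eq g hy (Finset.inter_eq_left.2 (sp_mono hy)).symm]
      simp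
    · intro i hi hne'
      rw [hk, sp_rm, if_pos (Finset.mem_erase.2 ⟨hne'.symm, hay⟩), smul_zero]
    · intro h; exact absurd hay h
  · rw [hk y, if_neg hay]
    set Y := fc g z (insert a (sp x y)) with hY
    have hsY : sp x Y = insert a (sp x y) := by
      rw [hY, sp_fc, Finset.inter_eq_left]
      exact Finset.insert_subset haz (sp_mono hy)
    have hYz : Y ≤ z := fc_le _ _ _
    rw [lx, Finsupp.linearCombination_single, one_smul, bdD, hsY, Finset.sum_insert hay]
    have h1 : (insert a (sp x y)).filter (fun l => l < a) = ∅ := by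
      rw [Finset.filter_eq_empty_iff]
      intro l hl
      rcases Finset.mem_insert.1 hl with rfl | hl
      · exact lt_irrefl _
      · exact not_lt.2 (hmin l (sp_mono hy hl))
    have h2 : rm g Y a = y := by
      apply g.eq_of_sp ((rm_le _ _ _).trans hYz) hy
      rw [sp_rm, hsY, Finset.erase_insert hay]
    rw [h1, h2, Finset.card_empty, pow_zero, one_smul, add_assoc, ← Finset.sum_add_distrib,
      Finset.sum_eq_zero, add_zero]
    intro i hi
    have hia : i ≠ a := fun h => hay (h ▸ hi)
    have h3 : a < i := lt_of_le_of_ne (hmin i (sp_mono hy hi)) hia.symm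
    have h4 : ((insert a (sp x y)).filter fun l => l < i).card =
        ((sp x y).filter fun l => l < i).card + 1 := by
      rw [Finset.filter_insert, if_pos h3, Finset.card_insert_of_notMem]
      intro h; exact hay (Finset.mem_filter.1 h).1
    have h5 : fc g z (insert a (sp x (rm g y i))) = rm g Y i := by
      apply fc_eq g ((rm_le _ _ _).trans hYz)
      rw [sp_rm, sp_rm, hsY, Finset.erase_insert_of_ne hia.symm, eq_comm, Finset.inter_eq_left]
      exact Finset.insert_subset haz ((Finset.erase_subset _ _).trans (sp_mono hy))
    rw [h4, hk, sp_rm, if_neg (fun h => hay (Finset.mem_of_mem_erase h)), ← sp_rm g, h5, pow_succ]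
    simp

/-- cellular carrier complex -/
abbrev DC (g : Good x) : CC P k where
  B := P
  car := id
  deg z := (sp x z).card
  bd := bdD k g
  bot := ⊥
  κ := kD k g
  bd_mem z := by
    apply Submodule.sum_mem
    intro i hi
    apply Submodule.smul_mem
    apply Finsupp.single_mem_supported
    refine ⟨rm_le _ _ _, ?_⟩
    rw [sp_rm]
    exact Finset.card_erase_add_one hi
  bd_bd := bdbdD k g
  car_bot _ h := h
  deg_bot := by rw [sp_bot g]; rfl
  deg_zero b h := (sp_eq_empty g).1 (Finset.card_eq_zero.1 h)
  κ_mem z y hy := by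
    rw [kD]
    split_ifs with h1 h2
    · exact zero_mem _
    · apply Finsupp.single_mem_supported
      refine ⟨fc_le _ _ _, ?_⟩
      rw [sp_fc, Finset.inter_eq_left.2, Finset.card_insert_of_notMem h2]
      exact Finset.insert_subset (Finset.min'_mem _ _) (sp_mono hy)
    · exact zero_mem _
  κ_id := kD_id k g

/-! order complex -/

theorem exists_car (s : Finset P) (hs : s ∈ chainsK P) :
    ∃ m : P, (∀ q ∈ s, q ≤ m) ∧ ((m = ⊥ ∧ s = ∅) ∨ m ∈ s) := by
  by_cases h : s.Nonempty
  · obtain ⟨m, hm⟩ := s.exists_maximal h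
    refine ⟨m, ?_, Or.inr hm.1⟩
    intro q hq
    rcases hs.2.total hq hm.1 with h1 | h1
    · exact h1
    · exact hm.2 hq h1
  · rw [Finset.not_nonempty_iff_eq_empty] at h
    exact ⟨⊥, by simp [h], Or.inl ⟨rfl, h⟩⟩

variable (P) in
abbrev CB := {s : Finset P // s ∈ chainsK P}

def carC (s : CB P) : P := (exists_car s.1 s.2).choose

theorem carC_le {s : CB P} {z : P} : carC s ≤ z ↔ ∀ q ∈ s.1, q ≤ z := by
  obtain ⟨h1, h2⟩ := (exists_car s.1 s.2).choose_spec
  constructor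
  · intro h q hq; exact (h1 q hq).trans h
  · intro h
    rcases h2 with ⟨h3, h4⟩ | h3
    · rw [carC, h3]; exact bot_le
    · exact h _ h3

theorem ne_bot_of_mem {s : CB P} {q : P} (h : q ∈ s.1) : q ≠ ⊥ := by
  rintro rfl
  exact s.2.1 _ h isMin_bot

theorem carC_mem {s : CB P} : (carC s = ⊥ ∧ s.1 = ∅) ∨ carC s ∈ s.1 :=
  (exists_car s.1 s.2).choose_spec.2

def er (s : CB P) (v : P) : CB P := ⟨s.1.erase v,
  fun q hq => s.2.1 q (Finset.mem_of_mem_erase hq),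
  s.2.2.mono (by intro q hq; exact Finset.mem_of_mem_erase (Finset.mem_coe.1 hq))⟩

def ins (z : P) (s : CB P) (hz : z ≠ ⊥) (h : carC s ≤ z) : CB P := ⟨insert z s.1, by
  constructor
  · intro q hq
    rcases Finset.mem_insert.1 hq with rfl | hq
    · rwa [isMin_iff_eq_bot]
    · exact s.2.1 q hq
  · rw [Finset.coe_insert]
    apply s.2.2.insert
    intro b hb _
    exact Or.inr (carC_le.1 h b hb)⟩

def bdC (s : CB P) : CB P →₀ k :=
  ∑ v ∈ s.1, ((-1 : k) ^ (s.1.filter fun u => u < v).card) • Finsupp.single (er s v) 1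

def kC (z : P) (s : CB P) : CB P →₀ k :=
  if h : z ≠ ⊥ ∧ carC s ≤ z then
    if z ∈ s.1 then 0 else ((-1 : k) ^ s.1.card) • Finsupp.single (ins z s h.1 h.2) 1
  else 0

theorem er_comm (s : CB P) (u v : P) : er (er s u) v = er (er s v) u :=
  Subtype.ext Finset.erase_right_comm

theorem carC_er (s : CB P) (u : P) : carC (er s u) ≤ carC s :=
  carC_le.2 fun q hq => carC_le.1 le_rfl q (Finset.mem_of_mem_erase hq)

theorem bdbdC (s : CB P) : lx (bdC k) (bdC k s) = 0 := by
  have h := sign_cancel (k := k) (fun u v : P => u < v) s.1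
    (fun u hu v hv huv => by
      constructor
      · intro h h'; exact lt_asymm h h'
      · intro h
        rcases s.2.2.total hu hv with h1 | h1
        · exact lt_of_le_of_ne h1 huv
        · exact absurd (lt_of_le_of_ne h1 huv.symm) h)
    (fun v u => Finsupp.single (er (er s v) u) (1 : k)) (fun u _ v _ => by rw [er_comm])
  rw [← h]
  conv_lhs => rw [bdC, map_sum]
  apply Finset.sum_congr rfl
  intro v hv
  rw [map_smul, lx, Finsupp.linearCombination_single, one_smul, bdC]
  rfl

theorem kC_id (z : P) (s : CB P) (hz : z ≠ ⊥) (hs : carC s ≤ z) :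
    lx (bdC k) (kC k z s) + lx (kC k z) (bdC k s) = Finsupp.single s 1 := by
  have hk : ∀ (s' : CB P) (h : carC s' ≤ z), kC k z s' = if z ∈ s'.1 then 0 else
      ((-1 : k) ^ s'.1.card) • Finsupp.single (ins z s' hz h) 1 := by
    intro s' h; rw [kC, dif_pos ⟨hz, h⟩]
  have her : ∀ v, carC (er s v) ≤ z := fun v => (carC_er s v).trans hs
  have hle := carC_le.1 hs
  have hbd : lx (kC k z) (bdC k s) = ∑ v ∈ s.1,
      ((-1 : k) ^ (s.1.filter fun u => u < v).card) • kC k z (er s v) := by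
    conv_lhs => rw [bdC, map_sum]
    apply Finset.sum_congr rfl
    intro v hv
    rw [map_smul, lx, Finsupp.linearCombination_single, one_smul]
  rw [hbd]
  have sq : ∀ m : ℕ, (-1 : k) ^ m * (-1 : k) ^ m = 1 := by
    intro m; rw [← mul_pow]; simp
  by_cases hzs : z ∈ s.1
  · rw [hk s hs, if_pos hzs, map_zero, zero_add, Finset.sum_eq_single z]
    · have h1 : s.1.filter (fun u => u < z) = s.1.erase z := by
        ext u
        rw [Finset.mem_filter, Finset.mem_erase]
        constructor
        · rintro ⟨h1, h2⟩; exact ⟨h2.ne, h1⟩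
        · rintro ⟨h1, h2⟩; exact ⟨h2, lt_of_le_of_ne (hle u h2) h1⟩
      have h2 : ins z (er s z) hz (her z) = s := Subtype.ext (Finset.insert_erase hzs)
      have h0 : z ∉ (er s z).1 := Finset.notMem_erase _ _
      rw [h1, hk _ (her z), if_neg h0, h2, smul_smul]
      change (_ * (-1 : k) ^ (s.1.erase z).card) • _ = _
      rw [sq, one_smul]
    · intro v hv hne
      have : z ∈ (er s v).1 := Finset.mem_erase.2 ⟨hne.symm, hzs⟩
      rw [hk _ (her v), if_pos this, smul_zero]
    · intro h; exact absurd hzs h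
  · rw [hk s hs, if_neg hzs, map_smul, lx, Finsupp.linearCombination_single, one_smul, bdC]
    change _ • (∑ v ∈ insert z s.1, ((-1 : k) ^ ((insert z s.1).filter fun u => u < v).card) • _)
      + _ = _
    rw [Finset.sum_insert hzs, smul_add, smul_smul]
    have h1 : (insert z s.1).filter (fun u => u < z) = s.1 := by
      rw [Finset.filter_insert, if_neg (lt_irrefl _), Finset.filter_eq_self]
      intro u hu
      exact lt_of_le_of_ne (hle u hu) (fun h => hzs (h ▸ hu))
    have h2 : er (ins z s hz hs) z = s := Subtype.ext (Finset.erase_insert hzs)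
    rw [h1, h2, sq, one_smul, add_assoc, Finset.smul_sum, ← Finset.sum_add_distrib,
      Finset.sum_eq_zero, add_zero]
    intro v hv
    have hvz : v ≠ z := fun h => hzs (h ▸ hv)
    have h3 : (insert z s.1).filter (fun u => u < v) = s.1.filter (fun u => u < v) := by
      rw [Finset.filter_insert, if_neg]
      exact fun h => absurd (hle v hv) (not_le_of_gt h)
    have h4 : er (ins z s hz hs) v = ins z (er s v) hz (her v) :=
      Subtype.ext (Finset.erase_insert_of_ne hvz.symm)
    have h5 : z ∉ (er s v).1 := fun h => hzs (Finset.mem_of_mem_erase h)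
    have h6 : s.1.card = (er s v).1.card + 1 := (Finset.card_erase_add_one hv).symm
    rw [h3, h4, hk _ (her v), if_neg h5, h6, smul_smul, smul_smul, ← add_smul]
    convert zero_smul k _
    ring

/-- order complex carrier complex -/
abbrev KC : CC P k where
  B := CB P
  car := carC
  deg s := s.1.card
  bd := bdC k
  bot := ⟨∅, by simp [chainsK]⟩
  κ := kC k
  bd_mem s := by
    apply Submodule.sum_mem
    intro i hi
    apply Submodule.smul_mem
    apply Finsupp.single_mem_supported
    exact ⟨carC_er _ _, Finset.card_erase_add_one hi⟩
  bd_bd := bdbdC k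
  car_bot s h := by
    rcases carC_mem (s := s) with ⟨_, h1⟩ | h1
    · exact Subtype.ext h1
    · exact absurd h (ne_bot_of_mem h1)
  deg_bot := rfl
  deg_zero b h := Subtype.ext (Finset.card_eq_zero.1 h)
  κ_mem z s hs := by
    rw [kC]
    split_ifs with h1 h2
    · exact zero_mem _
    · apply Submodule.smul_mem
      apply Finsupp.single_mem_supported
      refine ⟨carC_le.2 ?_, Finset.card_insert_of_notMem h2⟩
      intro q hq
      rcases Finset.mem_insert.1 hq with rfl | hq
      · exact le_rfl
      · exact carC_le.1 hs q hq
    · exact zero_mem _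
  κ_id := kC_id k

theorem KC_bot : (KC (P := P) k).car (KC k).bot = ⊥ := by
  have : carC (P := P) ⟨∅, by simp [chainsK]⟩ ≤ ⊥ := carC_le.2 (by simp)
  exact le_bot_iff.1 this

end Instances

section Coho

section HHsec
variable {k : Type} [Field k] {M : Type} [AddCommGroup M] [Module k M]

/-- cohomology at one spot -/
abbrev HH (d : M →ₗ[k] M) (G G' : Submodule k M) :=
  ↥(LinearMap.ker d ⊓ G) ⧸ Submodule.comap (LinearMap.ker d ⊓ G).subtype (Submodule.map d G')

variable {N : Type} [AddCommGroup N] [Module k N]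

structure QI (d : M →ₗ[k] M) (G G' : Submodule k M) (d' : N →ₗ[k] N) (K K' : Submodule k N)
    (φ : M →ₗ[k] N) : Prop where
  z_mem : ∀ z ∈ LinearMap.ker d ⊓ G, φ z ∈ LinearMap.ker d' ⊓ K
  b_iff : ∀ z ∈ LinearMap.ker d ⊓ G, φ z ∈ Submodule.map d' K' ↔ z ∈ Submodule.map d G'
  surj : ∀ z' ∈ LinearMap.ker d' ⊓ K, ∃ z ∈ LinearMap.ker d ⊓ G, φ z - z' ∈ Submodule.map d' K'

variable {d : M →ₗ[k] M} {G G' : Submodule k M} {d' : N →ₗ[k] N} {K K' : Submodule k N}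
    {φ : M →ₗ[k] N}

def QI.map (h : QI d G G' d' K K' φ) : HH d G G' →ₗ[k] HH d' K K' :=
  Submodule.mapQ _ _ (φ.restrict h.z_mem) (fun z hz => (h.b_iff z.1 z.2).2 hz)

theorem QI.map_mk (h : QI d G G' d' K K' φ) (z : ↥(LinearMap.ker d ⊓ G)) :
    h.map (Submodule.Quotient.mk z) = Submodule.Quotient.mk ⟨φ z.1, h.z_mem z.1 z.2⟩ := rfl

theorem QI.bij (h : QI d G G' d' K K' φ) : Function.Bijective h.map := by
  constructor
  · rw [← LinearMap.ker_eq_bot, eq_bot_iff]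
    intro q hq
    obtain ⟨z, rfl⟩ := Submodule.Quotient.mk_surjective _ q
    rw [LinearMap.mem_ker, h.map_mk, Submodule.Quotient.mk_eq_zero] at hq
    rw [Submodule.mem_bot, Submodule.Quotient.mk_eq_zero]
    exact (h.b_iff z.1 z.2).1 hq
  · intro q
    obtain ⟨z', rfl⟩ := Submodule.Quotient.mk_surjective _ q
    obtain ⟨z, hz, hzz⟩ := h.surj z'.1 z'.2
    refine ⟨Submodule.Quotient.mk ⟨z, hz⟩, ?_⟩
    rw [h.map_mk, Submodule.Quotient.eq]
    exact hzz

def QI.equiv (h : QI d G G' d' K K' φ) : HH d G G' ≃ₗ[k] HH d' K K' :=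
  LinearEquiv.ofBijective h.map h.bij

/-- product version -/
theorem HH_pi {W : Type} {NW : W → Type} [∀ w, AddCommGroup (NW w)] [∀ w, Module k (NW w)]
    (d : M →ₗ[k] M) (G0 G1 G2 : Submodule k M)
    (d' : ∀ w, NW w →ₗ[k] NW w) (K0 K1 : ∀ w, Submodule k (NW w))
    (φ : ∀ w, M →ₗ[k] NW w)
    (h01 : ∀ z ∈ G0, d z ∈ G1) (h12 : ∀ z ∈ G1, d z ∈ G2)
    (c0 : ∀ z ∈ G0, ∀ w, d' w (φ w z) = φ w (d z))
    (c1 : ∀ z ∈ G1, ∀ w, d' w (φ w z) = φ w (d z))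
    (m0 : ∀ z ∈ G0, ∀ w, φ w z ∈ K0 w) (m1 : ∀ z ∈ G1, ∀ w, φ w z ∈ K1 w)
    (i1 : ∀ z ∈ G1, (∀ w, φ w z = 0) → z = 0) (i2 : ∀ z ∈ G2, (∀ w, φ w z = 0) → z = 0)
    (s0 : ∀ y : ∀ w, NW w, (∀ w, y w ∈ K0 w) → ∃ z ∈ G0, ∀ w, φ w z = y w)
    (s1 : ∀ y : ∀ w, NW w, (∀ w, y w ∈ K1 w) → ∃ z ∈ G1, ∀ w, φ w z = y w) :
    Nonempty (HH d G1 G0 ≃ₗ[k] ((w : W) → HH (d' w) (K1 w) (K0 w))) := by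
  have hz : ∀ w, ∀ z ∈ LinearMap.ker d ⊓ G1, φ w z ∈ LinearMap.ker (d' w) ⊓ K1 w := by
    rintro w z ⟨h1, h2⟩
    refine ⟨?_, m1 z h2 w⟩
    change d' w (φ w z) = 0
    rw [c1 z h2, show d z = 0 from h1, map_zero]
  let f : ∀ w, HH d G1 G0 →ₗ[k] HH (d' w) (K1 w) (K0 w) := fun w =>
    Submodule.mapQ _ _ ((φ w).restrict (hz w)) (by
      rintro z ⟨y, hy, hyz⟩
      exact ⟨φ w y, m0 y hy w, by rw [c0 y hy w, hyz]; rfl⟩)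
  refine ⟨LinearEquiv.ofBijective (LinearMap.pi f) ⟨?_, ?_⟩⟩
  · rw [← LinearMap.ker_eq_bot, eq_bot_iff]
    intro q hq
    obtain ⟨z, rfl⟩ := Submodule.Quotient.mk_surjective _ q
    rw [LinearMap.mem_ker] at hq
    have h1 : ∀ w, ∃ y ∈ K0 w, d' w y = φ w z.1 := by
      intro w
      have h2 : f w (Submodule.Quotient.mk z) = 0 := congrFun hq w
      have h3 : f w (Submodule.Quotient.mk z) = Submodule.Quotient.mk ⟨φ w z.1, hz w z.1 z.2⟩ := rfl
      rw [h3, Submodule.Quotient.mk_eq_zero] at h2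
      exact h2
    choose y hy hyz using h1
    obtain ⟨u, hu, huy⟩ := s0 y hy
    rw [Submodule.mem_bot, Submodule.Quotient.mk_eq_zero]
    refine ⟨u, hu, ?_⟩
    have := i1 (d u - z.1) (Submodule.sub_mem _ (h01 u hu) z.2.2) (fun w => by
      rw [map_sub, ← c0 u hu, huy, hyz, sub_self])
    exact sub_eq_zero.1 this
  · intro q
    choose y hy using fun w => Submodule.Quotient.mk_surjective _ (q w)
    obtain ⟨z, hzG, hzy⟩ := s1 (fun w => (y w).1) (fun w => (y w).2.2)
    have hdz : d z = 0 := i2 _ (h12 z hzG) (fun w => by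
      rw [← c1 z hzG, hzy]; exact (y w).2.1)
    refine ⟨Submodule.Quotient.mk ⟨z, hdz, hzG⟩, ?_⟩
    funext w
    rw [← hy w]
    have h3 : f w (Submodule.Quotient.mk ⟨z, hdz, hzG⟩) =
      Submodule.Quotient.mk ⟨φ w z, hz w z ⟨hdz, hzG⟩⟩ := rfl
    refine Eq.trans (show LinearMap.pi f _ w = f w (Submodule.Quotient.mk ⟨z, hdz, hzG⟩) from rfl)
      (h3.trans ?_)
    congr 1
    exact Subtype.ext (hzy w)

end HHsec

section Cochains
variable {P : Type} [PartialOrder P] [OrderBot P] {k : Type} [Field k]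

/-- transpose of a linear map -/
def star' {B B' : Type} (F : (B →₀ k) →ₗ[k] (B' →₀ k)) : (B' → k) →ₗ[k] (B → k) where
  toFun f b := lx f (F (Finsupp.single b 1))
  map_add' f f' := by
    funext b
    simp [lx, Finsupp.linearCombination_apply, Finsupp.sum, mul_add, Finset.sum_add_distrib]
  map_smul' c f := by
    funext b
    simp only [lx, Finsupp.linearCombination_apply, Finsupp.sum, Pi.smul_apply, smul_eq_mul,
      RingHom.id_apply, Finset.mul_sum]
    exact Finset.sum_congr rfl fun _ _ => by ring

theorem star'_apply {B B' : Type} (F : (B →₀ k) →ₗ[k] (B' →₀ k)) (f : B' → k) (b : B) :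
    star' F f b = lx f (F (Finsupp.single b 1)) := rfl

theorem lx_star' {B B' : Type} (F : (B →₀ k) →ₗ[k] (B' →₀ k)) (f : B' → k) (c : B →₀ k) :
    lx (star' F f) c = lx f (F c) := by
  have : lx (star' F f) = (lx f).comp F := by
    apply Finsupp.lhom_ext'
    intro b
    apply LinearMap.ext_ring
    simp [lx, star'_apply]
  rw [this]; rfl

/-- graded cochains supported on `U` -/
def cg (C : CC P k) (U : Set P) (d : ℤ) : Submodule k (C.B → k) where
  carrier := {f | ∀ b, ¬ (C.car b ∈ U ∧ (C.deg b : ℤ) = d) → f b = 0}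
  zero_mem' := fun _ _ => rfl
  add_mem' := fun {f f'} h h' b hb => by rw [Pi.add_apply, h b hb, h' b hb, add_zero]
  smul_mem' := fun c f h b hb => by rw [Pi.smul_apply, h b hb, smul_zero]

theorem star'_mem {C C' : CC P k} {U : Set P} (hU : IsUpperSet U) {d s : ℤ}
    {F : (C.B →₀ k) →ₗ[k] (C'.B →₀ k)}
    (hF : ∀ b, F (Finsupp.single b 1) ∈
      Finsupp.supported k k {b' | C'.car b' ≤ C.car b ∧ (C'.deg b' : ℤ) = C.deg b + s})
    {f : C'.B → k} (hf : f ∈ cg C' U d) : star' F f ∈ cg C U (d - s) := by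
  intro b hb
  have := lx_mem (v := f) (N := ⊥) (fun b' hb' => ?_) (hF b)
  · exact this
  · rw [Submodule.mem_bot]
    apply hf
    rintro ⟨h1, h2⟩
    exact hb ⟨hU hb'.1 h1, by have := hb'.2; omega⟩

/-- coboundary -/
def cobd (C : CC P k) : (C.B → k) →ₗ[k] (C.B → k) := star' C.dd

theorem cobd_apply (C : CC P k) (f : C.B → k) (b : C.B) : cobd C f b = lx f (C.bd b) := by
  rw [cobd, star'_apply, CC.dd_single]

theorem cobd_mem {C : CC P k} {U : Set P} (hU : IsUpperSet U) {d : ℤ} {f : C.B → k}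
    (hf : f ∈ cg C U d) : cobd C f ∈ cg C U (d + 1) := by
  have := star'_mem (C := C) (C' := C) (s := -1) (F := C.dd) hU (fun b => ?_) hf
  · rwa [sub_neg_eq_add] at this
  · rw [CC.dd_single]
    refine Finsupp.supported_mono ?_ (C.bd_mem b)
    rintro b' ⟨h1, h2⟩
    exact ⟨h1, by omega⟩

theorem QI_of_CC {C C' : CC P k} (hb : C.car C.bot = ⊥) (hb' : C'.car C'.bot = ⊥)
    {U : Set P} (hU : IsUpperSet U) (t : ℤ) :
    ∃ φ, QI (cobd C) (cg C U t) (cg C U (t - 1)) (cobd C') (cg C' U t) (cg C' U (t - 1)) φ := by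
  have gen : ∀ (C C' : CC P k) (F : (C.B →₀ k) →ₗ[k] (C'.B →₀ k)), C.IsCM C' F →
      (∀ d f, f ∈ cg C' U d → star' F f ∈ cg C U d) ∧
      (∀ f, cobd C (star' F f) = star' F (cobd C' f)) := by
    intro C C' F hF
    constructor
    · intro d f hf
      have := star'_mem (s := 0) (F := F) hU (fun b => ?_) hf
      · rwa [sub_zero] at this
      · refine Finsupp.supported_mono ?_ (hF.mem b)
        rintro b' ⟨h1, h2⟩
        exact ⟨h1, by omega⟩
    · intro f
      funext b
      rw [cobd, star'_apply, lx_star', star'_apply, cobd, lx_star', hF.comm]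
  have genH : ∀ (C : CC P k) (F : (C.B →₀ k) →ₗ[k] (C.B →₀ k)), C.IsCM C F →
      ∀ f ∈ LinearMap.ker (cobd C) ⊓ cg C U t,
        star' F f - f ∈ Submodule.map (cobd C) (cg C U (t - 1)) := by
    rintro C F hF f ⟨hf1, hf2⟩
    obtain ⟨H, hH1, hH2⟩ := CC.exists_ht hF (CC.IsCM.id C)
    refine ⟨star' H f, ?_, ?_⟩
    · refine star'_mem (s := 1) (F := H) hU (fun b => ?_) hf2
      refine Finsupp.supported_mono ?_ (hH1 b)
      rintro b' ⟨h1, h2⟩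
      exact ⟨h1, by rw [h2]; push_cast; rfl⟩
    · funext b
      have h1 := congrArg (lx f) (hH2 b)
      rw [map_add, map_sub] at h1
      have h2 : lx f (C.dd (H (Finsupp.single b 1))) = 0 := by
        rw [← lx_star']
        have : star' C.dd f = 0 := hf1
        rw [this]
        simp [lx, Finsupp.linearCombination_apply]
      rw [h2, zero_add] at h1
      rw [cobd_apply, lx_star', h1, Pi.sub_apply, star'_apply]
      simp [lx]
  have hψ := CC.cm_isCM C C' hb'
  have hφ := CC.cm_isCM C' C hb
  obtain ⟨φm, φc⟩ := gen C' C _ hφ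
  obtain ⟨ψm, ψc⟩ := gen C C' _ hψ
  have hcomp : ∀ {B B' B'' : Type} (F : (B →₀ k) →ₗ[k] (B' →₀ k)) (F' : (B' →₀ k) →ₗ[k] (B'' →₀ k))
      (f : B'' → k), star' F (star' F' f) = star' (F'.comp F) f := by
    intro B B' B'' F F' f
    funext b
    rw [star'_apply, lx_star']; rfl
  refine ⟨star' (CC.cm C' C), ?_, ?_, ?_⟩
  · rintro z ⟨h1, h2⟩
    refine ⟨?_, φm _ _ h2⟩
    change cobd C' (star' _ z) = 0
    rw [φc, show cobd C z = 0 from h1, map_zero]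
  · intro z hz
    constructor
    · rintro ⟨y, hy, hyz⟩
      have h1 := genH C _ (hφ.comp hψ) z hz
      rw [← hcomp, ← hyz, ← ψc] at h1
      have h2 : cobd C (star' (CC.cm C C') y) ∈ Submodule.map (cobd C) (cg C U (t - 1)) :=
        ⟨_, ψm _ _ hy, rfl⟩
      have := Submodule.sub_mem _ h2 h1
      rwa [sub_sub_cancel] at this
    · rintro ⟨y, hy, rfl⟩
      exact ⟨_, φm _ _ hy, φc y⟩
  · rintro z' ⟨h1, h2⟩
    refine ⟨star' (CC.cm C C') z', ⟨?_, ψm _ _ h2⟩, ?_⟩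
    · change cobd C (star' _ z') = 0
      rw [ψc, show cobd C' z' = 0 from h1, map_zero]
    · rw [hcomp]
      exact genH C' _ (hψ.comp hφ) z' ⟨h1, h2⟩

end Cochains

section Rel
variable {P k}
variable {W : Type} (wv : W → P)

theorem mem_relK {s : CB P} {w : P} (hw : w ≠ ⊥) : s.1 ∈ relK P (cost w) ↔ w ≤ carC s := by
  constructor
  · rintro ⟨_, h⟩
    obtain ⟨q, hq, hqw⟩ := Set.not_subset.1 h
    have : w ≤ q := by simpa [cost] using hqw
    exact this.trans (carC_le.1 le_rfl q hq)
  · intro h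
    refine ⟨s.2, ?_⟩
    rcases carC_mem (s := s) with ⟨h1, _⟩ | h1
    · rw [h1, le_bot_iff] at h; exact absurd h hw
    · intro hsub
      exact hsub h1 h

/-- restriction of cochains -/
def resw (w : P) : (CB P → k) →ₗ[k] (Finset P → k) where
  toFun f s := if h : s ∈ relK P (cost w) then f ⟨s, h.1⟩ else 0
  map_add' f f' := by funext s; by_cases h : s ∈ relK P (cost w) <;> simp [h]
  map_smul' c f := by funext s; by_cases h : s ∈ relK P (cost w) <;> simp [h]

theorem resw_pos {w : P} (f : CB P → k) (s : CB P) (h : s.1 ∈ relK P (cost w)) :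
    resw w f s.1 = f s := by
  change (if h : _ then _ else _) = _
  rw [dif_pos h]

theorem resw_neg {w : P} (f : CB P → k) {s : Finset P} (h : s ∉ relK P (cost w)) :
    resw w f s = 0 := by
  change (if h : _ then _ else _) = _
  rw [dif_neg h]

theorem mem_cGraded {Q : Type} [Fintype Q] [PartialOrder Q] {K : Set (Finset Q)} {i : ℤ}
    {f : Finset Q → k} :
    f ∈ cGraded k Q K i ↔ ∀ s, ¬ (s ∈ K ∧ (s.card : ℤ) = i + 1) → f s = 0 := by
  rw [cGraded, Submodule.mem_pi]
  constructor
  · intro h s hs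
    have := h s (Set.mem_univ _)
    rw [if_neg hs] at this
    exact (Submodule.mem_bot k).1 this
  · intro h s _
    split_ifs with hs
    · trivial
    · exact (Submodule.mem_bot k).2 (h s hs)

theorem KC_equiv_rel (hw : ∀ w, wv w ≠ ⊥) (hun : ∀ w w' z, wv w ≤ z → wv w' ≤ z → w = w')
    (U : Set P) (hU : ∀ z, z ∈ U ↔ ∃ w, wv w ≤ z) (t : ℤ) :
    Nonempty (HH (cobd (KC (P := P) k)) (cg (KC k) U t) (cg (KC k) U (t - 1)) ≃ₗ[k]
      ((w : W) → RelCoh k P (cost (wv w)) (t - 1))) := by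
  have hUp : IsUpperSet U := by
    intro a b hab ha
    obtain ⟨w, h⟩ := (hU a).1 ha
    exact (hU b).2 ⟨w, h.trans hab⟩
  have comm : ∀ d, ∀ z ∈ cg (KC (P := P) k) U d, ∀ w : W,
      cDelta k P (relK P (cost (wv w))) (resw (wv w) z) = resw (wv w) (cobd (KC k) z) := by
    intro d z hz w
    funext s
    by_cases hs : s ∈ relK P (cost (wv w))
    · have e1 := resw_pos (cobd (KC k) z) ⟨s, hs.1⟩ hs
      simp only at e1
      rw [e1]
      erw [cobd_apply]
      change _ = lx z (bdC k ⟨s, hs.1⟩)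
      rw [bdC, map_sum]
      simp only [cDelta, LinearMap.pi_apply, if_pos hs, LinearMap.sum_apply, LinearMap.smul_apply,
        LinearMap.proj_apply, map_smul]
      apply Finset.sum_congr rfl
      intro v hv
      congr 1
      rw [lx, Finsupp.linearCombination_single, one_smul]
      by_cases hsv : s.erase v ∈ relK P (cost (wv w))
      · exact resw_pos z (er ⟨s, hs.1⟩ v) hsv
      · rw [resw_neg _ hsv]
        symm
        apply hz
        rintro ⟨h1, _⟩
        obtain ⟨w', hw'⟩ := (hU _).1 h1
        apply hsv
        have h2 : wv w ≤ carC ⟨s, hs.1⟩ := (mem_relK (s := ⟨s, hs.1⟩) (hw w)).1 hs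
        have h3 := hun w w' _ h2 (hw'.trans (carC_er ⟨s, hs.1⟩ v))
        subst h3
        exact (mem_relK (s := er ⟨s, hs.1⟩ v) (hw w)).2 hw'
    · rw [resw_neg _ hs]
      simp [cDelta, hs]
  have mem : ∀ d, ∀ z ∈ cg (KC (P := P) k) U d, ∀ w : W,
      resw (wv w) z ∈ cGraded k P (relK P (cost (wv w))) (d - 1) := by
    intro d z hz w
    rw [mem_cGraded]
    intro s hs
    by_cases h : s ∈ relK P (cost (wv w))
    · rw [resw_pos z ⟨s, h.1⟩ h]
      apply hz
      rintro ⟨_, h2⟩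
      apply hs
      refine ⟨h, ?_⟩
      have : (s.card : ℤ) = d := h2
      omega
    · exact resw_neg _ h
  have inj : ∀ d, ∀ z ∈ cg (KC (P := P) k) U d, (∀ w : W, resw (wv w) z = 0) → z = 0 := by
    intro d z hz h
    funext s
    by_cases hs : carC s ∈ U
    · obtain ⟨w, h1⟩ := (hU _).1 hs
      have h2 := (mem_relK (s := s) (hw w)).2 h1
      rw [← resw_pos z s h2, h w]; rfl
    · exact hz s fun h => hs h.1
  have surj : ∀ d, ∀ y : W → (Finset P → k),
      (∀ w, y w ∈ cGraded k P (relK P (cost (wv w))) (d - 1)) →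
      ∃ z ∈ cg (KC (P := P) k) U d, ∀ w, resw (wv w) z = y w := by
    intro d y hy
    let z : CB P → k := fun s => if h : ∃ w, wv w ≤ carC s then y h.choose s.1 else 0
    have hzv : ∀ (s : CB P) w, wv w ≤ carC s → z s = y w s.1 := by
      intro s w h
      have hex : ∃ w, wv w ≤ carC s := ⟨w, h⟩
      have : hex.choose = w := hun _ _ _ hex.choose_spec h
      simp only [z]
      rw [dif_pos hex, this]
    refine ⟨z, ?_, ?_⟩
    · intro s hs
      by_cases hex : ∃ w, wv w ≤ carC s
      · obtain ⟨w, h⟩ := hex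
        rw [hzv s w h]
        apply mem_cGraded.1 (hy w)
        rintro ⟨_, h2⟩
        apply hs
        refine ⟨(hU _).2 ⟨w, h⟩, ?_⟩
        change (s.1.card : ℤ) = d
        omega
      · simp only [z]; rw [dif_neg hex]
    · intro w
      funext s
      by_cases h : s ∈ relK P (cost (wv w))
      · rw [resw_pos z ⟨s, h.1⟩ h]
        exact hzv ⟨s, h.1⟩ w ((mem_relK (s := ⟨s, h.1⟩) (hw w)).1 h)
      · rw [resw_neg _ h]
        symm
        exact mem_cGraded.1 (hy w) s fun h' => h h'.1
  refine HH_pi (cobd (KC (P := P) k)) (cg (KC k) U (t - 1)) (cg (KC k) U t) (cg (KC k) U (t + 1))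
    (fun w => cDelta k P (relK P (cost (wv w))))
    (fun w => cGraded k P (relK P (cost (wv w))) (t - 1 - 1))
    (fun w => cGraded k P (relK P (cost (wv w))) (t - 1))
    (fun w => resw (wv w)) ?_ ?_ (comm _) (comm _) (mem _) (mem _) (inj _) (inj _) (surj _) (surj _)
  · intro z hz
    have := cobd_mem hUp hz
    rwa [sub_add_cancel] at this
  · intro z hz
    exact cobd_mem hUp hz

end Rel

end Coho

section PhiSec
variable {P k n x}

/-- faces whose support contains the support of `α` -/
def Us (x : Fin n → P) (α : Fin n → ℤ) : Set P := {z | ∀ i, α i ≠ 0 → x i ≤ z}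

theorem Us_upper (α : Fin n → ℤ) : IsUpperSet (Us x α) :=
  fun _ _ hab ha i hi => (ha i hi).trans hab

theorem mem_gradedKC {ℓ t : ℕ} {α : Fin n → ℤ} {f : KCochain P k n} :
    f ∈ gradedKC P k n x ℓ t α ↔ ∀ G : Finset (Fin n),
      (G.card = t → f G ∈ facePiece P k n x (fun j => α j + if j ∈ G then (ℓ : ℤ) else 0)) ∧
      (G.card ≠ t → f G = 0) := by
  rw [gradedKC, Submodule.mem_pi]
  constructor
  · intro h G
    have := h G (Set.mem_univ _)
    constructor
    · intro hG; rwa [if_pos hG] at this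
    · intro hG; rw [if_neg hG] at this; exact (Submodule.mem_bot k).1 this
  · intro h G _
    by_cases hG : G.card = t
    · rw [if_pos hG]; exact (h G).1 hG
    · rw [if_neg hG]; exact (Submodule.mem_bot k).2 ((h G).2 hG)

theorem koszulD_apply (ℓ : ℕ) (f : KCochain P k n) (G : Finset (Fin n)) :
    koszulD P k n x ℓ f G = ∑ j ∈ G, ((-1 : k) ^ ((G.filter fun i => i < j).card)) •
      ((fv P k (x j)) ^ ℓ * f (G.erase j)) := by
  simp [koszulD, LinearMap.sum_apply]

theorem transKC_apply (f : KCochain P k n) (G : Finset (Fin n)) :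
    transKC P k n x f G = (∏ j ∈ G, fv P k (x j)) * f G := rfl

theorem mulKC_apply (j : Fin n) (f : KCochain P k n) (G : Finset (Fin n)) :
    mulKC P k n x j f G = fv P k (x j) * f G := rfl

theorem koszulD_mem (g : Good x) {ℓ t : ℕ} {α : Fin n → ℤ} {f : KCochain P k n}
    (hf : f ∈ gradedKC P k n x ℓ t α) :
    koszulD P k n x ℓ f ∈ gradedKC P k n x ℓ (t + 1) α := by
  rw [mem_gradedKC] at hf ⊢
  intro G
  rw [koszulD_apply]
  constructor
  · intro hG
    refine Submodule.sum_mem _ fun j hj => Submodule.smul_mem _ _ ?_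
    have hc : (G.erase j).card = t := by rw [Finset.card_erase_of_mem hj, hG]; rfl
    have := facePiece_mul (fvx_pow_mem (k := k) g j ℓ) ((hf (G.erase j)).1 hc)
    convert this using 1
    congr 1
    funext i
    by_cases hij : i = j
    · subst hij; simp [hj, add_comm]
    · simp [hij]
  · intro hG
    refine Finset.sum_eq_zero fun j hj => ?_
    rw [(hf (G.erase j)).2, mul_zero, smul_zero]
    intro hc
    apply hG
    rw [← hc, Finset.card_erase_add_one hj]

theorem gr_zero {ℓ t : ℕ} {α : Fin n → ℤ} (hα : ∀ i, α i ≤ 0) {f : KCochain P k n}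
    (hf : f ∈ gradedKC P k n x ℓ t α) {G : Finset (Fin n)} {i : Fin n} (hi : α i ≠ 0)
    (hG : i ∉ G) : f G = 0 := by
  rw [mem_gradedKC] at hf
  by_cases hc : G.card = t
  · have h1 := (hf G).1 hc
    rw [facePiece_neg (i := i)] at h1
    · exact (Submodule.mem_bot k).1 h1
    · have := hα i
      simp only [hG, if_false, add_zero]
      omega
  · exact (hf G).2 hc

/-- evaluation of Koszul cochains on faces -/
def Phi (g : Good x) : KCochain P k n →ₗ[k] (P → k) :=
  LinearMap.pi fun F => (ev k g F).toLinearMap.comp (LinearMap.proj (sp x F))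

theorem Phi_apply (g : Good x) (f : KCochain P k n) (F : P) :
    Phi g f F = ev k g F (f (sp x F)) := rfl

theorem Phi_comm (g : Good x) {ℓ t : ℕ} {α : Fin n → ℤ} (hα : ∀ i, α i ≤ 0)
    {f : KCochain P k n} (hf : f ∈ gradedKC P k n x ℓ t α) :
    Phi g (koszulD P k n x ℓ f) = cobd (DC k g) (Phi g f) := by
  funext F
  have h1 : cobd (DC k g) (Phi g f) F = lx (Phi g f) (bdD k g F) := cobd_apply _ _ _
  rw [h1, Phi_apply, koszulD_apply, map_sum, bdD, map_sum]
  apply Finset.sum_congr rfl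
  intro j hj
  rw [map_smul, map_smul, map_mul, map_pow, ev_fv, if_pos (mem_sp.1 hj), one_pow, one_mul]
  congr 1
  rw [lx, Finsupp.linearCombination_single, one_smul, Phi_apply, sp_rm]
  by_cases hz : f ((sp x F).erase j) = 0
  · rw [hz, map_zero, map_zero]
  · have hc : ((sp x F).erase j).card = t := by
      by_contra hc; exact hz ((mem_gradedKC.1 hf _).2 hc)
    refine ev_fc g (Finset.erase_subset _ _) ?_ ((mem_gradedKC.1 hf _).1 hc)
    intro i hi
    have : α i = 0 := by
      by_contra h; exact hz (gr_zero hα hf h hi)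
    simp [hi, this]

theorem Phi_inj (g : Good x) {ℓ t : ℕ} {α : Fin n → ℤ} (hα : ∀ i, α i ≤ 0)
    (hl : ∀ i, -α i < ℓ) {f : KCochain P k n} (hf : f ∈ gradedKC P k n x ℓ t α)
    (h0 : Phi g f = 0) : f = 0 := by
  funext G
  by_cases hc : G.card = t
  · by_cases hi : ∃ i, α i ≠ 0 ∧ i ∉ G
    · obtain ⟨i, h1, h2⟩ := hi
      exact gr_zero hα hf h1 h2
    · push Not at hi
      refine facePiece_inj g ((mem_gradedKC.1 hf G).1 hc) ?_
      intro F hF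
      have : sp x F = G := by
        ext i
        rw [mem_sp, hF i]
        by_cases h : i ∈ G
        · have := hl i
          simp only [h, if_true, iff_true]; omega
        · have : α i = 0 := by
            by_contra h'; exact h (hi i h')
          simp [h, this]
      have h2 := congrFun h0 F
      rw [Phi_apply, this] at h2
      exact h2
  · exact (mem_gradedKC.1 hf G).2 hc

theorem Phi_mem (g : Good x) {ℓ t : ℕ} {α : Fin n → ℤ} (hα : ∀ i, α i ≤ 0)
    {f : KCochain P k n} (hf : f ∈ gradedKC P k n x ℓ t α) :
    Phi g f ∈ cg (DC k g) (Us x α) t := by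
  intro F hF
  rw [Phi_apply]
  suffices h : f (sp x F) = 0 by rw [h, map_zero]
  by_cases hU : F ∈ Us x α
  · apply (mem_gradedKC.1 hf _).2
    intro hc
    apply hF
    exact ⟨hU, by change ((sp x F).card : ℤ) = t; rw [hc]⟩
  · simp only [Us, Set.mem_ofPred_eq, not_forall] at hU
    obtain ⟨i, h1, h2⟩ := hU
    exact gr_zero hα hf h1 (fun h => h2 (mem_sp.1 h))

theorem Phi_surj (g : Good x) {ℓ t : ℕ} {α : Fin n → ℤ} (hα : ∀ i, α i ≤ 0)
    (hl : ∀ i, -α i < ℓ) {y : P → k} (hy : y ∈ cg (DC k g) (Us x α) t) :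
    ∃ f ∈ gradedKC P k n x ℓ t α, Phi g f = y := by
  let a : Finset (Fin n) → Fin n → ℕ := fun G i =>
    (α i + (if i ∈ G then (ℓ : ℤ) else 0) - if i ∈ G then 1 else 0).toNat
  let f : KCochain P k n := fun G =>
    ∑ F ∈ Finset.univ.filter (fun F => sp x F = G), y F • mon k x F (a G)
  refine ⟨f, ?_, ?_⟩
  · rw [mem_gradedKC]
    intro G
    constructor
    · intro hG
      refine Submodule.sum_mem _ fun F hF => ?_
      have hF : sp x F = G := (Finset.mem_filter.1 hF).2
      by_cases hyF : y F = 0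
      · rw [hyF, zero_smul]; exact Submodule.zero_mem _
      · refine Submodule.smul_mem _ _ (mon_mem g fun i => ?_)
        have hU : F ∈ Us x α := by
          by_contra h; exact hyF (hy F fun h' => h h'.1)
        have e : (x i ≤ F) ↔ i ∈ G := by rw [← hF, mem_sp]
        simp only [a, e]
        by_cases hi : i ∈ G
        · have := hl i
          simp only [hi, if_true]; omega
        · have : α i = 0 := by
            by_contra h'; exact hi (e.1 (hU i h'))
          simp [hi, this]
    · intro hG
      refine Finset.sum_eq_zero fun F hF => ?_
      have hF : sp x F = G := (Finset.mem_filter.1 hF).2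
      rw [hy F, zero_smul]
      rintro ⟨_, h2⟩
      have h3 : ((sp x F).card : ℤ) = t := h2
      rw [hF] at h3
      exact hG (by exact_mod_cast h3)
  · funext F'
    rw [Phi_apply]
    simp only [f, map_sum, map_smul]
    rw [Finset.sum_eq_single F']
    · rw [ev_monNF g ?_ rfl, if_pos rfl, smul_eq_mul, mul_one]
      intro i hi
      by_contra h
      apply hi
      have : i ∉ sp x F' := fun h' => h (mem_sp.1 h')
      have := hα i
      simp only [a, *, if_false]
      omega
    · intro F hF hne
      have hF : sp x F = sp x F' := (Finset.mem_filter.1 hF).2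
      rw [ev_monNF g ?_ hF, if_neg hne, smul_zero]
      intro i hi
      by_contra h
      apply hi
      have : i ∉ sp x F' := fun h' => h (by rw [← hF] at h'; exact mem_sp.1 h')
      have := hα i
      simp only [a, *, if_false]
      omega
    · intro h
      exfalso
      apply h
      simp only [Finset.mem_filter, Finset.mem_univ, and_self]

theorem Phi_QI (g : Good x) {ℓ t : ℕ} {α : Fin n → ℤ} (hα : ∀ i, α i ≤ 0)
    (hl : ∀ i, -α i < ℓ) :
    QI (koszulD P k n x ℓ) (gradedKC P k n x ℓ t α) (gradedKC P k n x ℓ (t - 1) α)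
      (cobd (DC k g)) (cg (DC k g) (Us x α) t) (cg (DC k g) (Us x α) ((t : ℤ) - 1)) (Phi g) := by
  refine ⟨?_, ?_, ?_⟩
  · rintro z ⟨h1, h2⟩
    refine ⟨?_, Phi_mem g hα h2⟩
    change cobd (DC k g) (Phi g z) = 0
    rw [← Phi_comm g hα h2, show koszulD P k n x ℓ z = 0 from h1, map_zero]
  · rintro z ⟨h1, h2⟩
    rcases t with _ | s
    · constructor
      · rintro ⟨y, hy, hyz⟩
        have hy0 : y = 0 := by
          funext F
          apply hy F
          rintro ⟨_, h⟩
          have : (0 : ℤ) ≤ ((DC k g).deg F : ℤ) := Int.natCast_nonneg _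
          rw [h] at this
          simp at this
        rw [hy0, map_zero] at hyz
        rw [Phi_inj g hα hl h2 hyz.symm]
        exact Submodule.zero_mem _
      · rintro ⟨y, hy, rfl⟩
        have h3 : koszulD P k n x ℓ y = 0 := by
          have hd := koszulD_mem g hy
          funext G
          by_cases hc : G.card = 0
          · exact (mem_gradedKC.1 hd G).2 (by omega)
          · exact (mem_gradedKC.1 h2 G).2 hc
        rw [h3, map_zero]
        exact Submodule.zero_mem _
    · have e1 : ((s + 1 : ℕ) : ℤ) - 1 = (s : ℤ) := by push_cast; ring
      rw [e1]
      change _ ↔ z ∈ Submodule.map _ (gradedKC P k n x ℓ s α)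
      constructor
      · rintro ⟨y, hy, hyz⟩
        obtain ⟨f, hf, rfl⟩ := Phi_surj g hα hl hy
        refine ⟨f, hf, ?_⟩
        rw [← Phi_comm g hα hf] at hyz
        have := Phi_inj g hα hl (Submodule.sub_mem _ (koszulD_mem g hf) h2)
          (by rw [map_sub, hyz, sub_self])
        exact sub_eq_zero.1 this
      · rintro ⟨y, hy, rfl⟩
        exact ⟨Phi g y, Phi_mem g hα hy, (Phi_comm g hα hy).symm⟩
  · rintro z' ⟨h1, h2⟩
    obtain ⟨f, hf, rfl⟩ := Phi_surj g hα hl h2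
    refine ⟨f, ⟨?_, hf⟩, ?_⟩
    · change koszulD P k n x ℓ f = 0
      refine Phi_inj g hα hl (koszulD_mem g hf) ?_
      rw [Phi_comm g hα hf]; exact h1
    · rw [sub_self]; exact Submodule.zero_mem _

theorem Phi_trans (g : Good x) (f : KCochain P k n) : Phi g (transKC P k n x f) = Phi g f := by
  funext F
  rw [Phi_apply, transKC_apply, map_mul, map_prod, Finset.prod_eq_one, one_mul, Phi_apply]
  intro j hj
  rw [ev_fv, if_pos (mem_sp.1 hj)]

theorem Phi_mul (g : Good x) {ℓ t : ℕ} {α : Fin n → ℤ} (hα : ∀ i, α i ≤ 0) {j : Fin n}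
    (hj : α j ≠ 0) {f : KCochain P k n} (hf : f ∈ gradedKC P k n x ℓ t α) :
    Phi g (mulKC P k n x j f) = Phi g f := by
  funext F
  rw [Phi_apply, mulKC_apply, map_mul, Phi_apply, ev_fv]
  by_cases h : x j ≤ F
  · rw [if_pos h, one_mul]
  · rw [gr_zero hα hf hj (fun h' => h (mem_sp.1 h')), map_zero, mul_zero]

theorem trans_mem (g : Good x) {ℓ t : ℕ} {α : Fin n → ℤ} {f : KCochain P k n}
    (hf : f ∈ gradedKC P k n x ℓ t α) : transKC P k n x f ∈ gradedKC P k n x (ℓ + 1) t α := by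
  rw [mem_gradedKC] at hf ⊢
  intro G
  rw [transKC_apply]
  constructor
  · intro hG
    have h1 := prod_mem_facePiece (k := k) g (fun _ => 1) G
    simp only [pow_one] at h1
    convert facePiece_mul h1 ((hf G).1 hG) using 1
    congr 1
    funext i
    by_cases h : i ∈ G
    · simp [h]; ring
    · simp [h]
  · intro hG
    rw [(hf G).2 hG, mul_zero]

theorem trans_comm (ℓ : ℕ) (f : KCochain P k n) :
    koszulD P k n x (ℓ + 1) (transKC P k n x f) = transKC P k n x (koszulD P k n x ℓ f) := by
  funext G
  rw [koszulD_apply, transKC_apply, koszulD_apply, Finset.mul_sum]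
  apply Finset.sum_congr rfl
  intro j hj
  rw [mul_smul_comm, transKC_apply, ← Finset.mul_prod_erase G _ hj]
  congr 1
  ring

theorem mulKC_mem (g : Good x) {ℓ t : ℕ} {α γ : Fin n → ℤ} {j : Fin n}
    (hγ : γ = fun i => if i = j then α i + 1 else α i) {f : KCochain P k n}
    (hf : f ∈ gradedKC P k n x ℓ t α) : mulKC P k n x j f ∈ gradedKC P k n x ℓ t γ := by
  rw [mem_gradedKC] at hf ⊢
  intro G
  rw [mulKC_apply]
  constructor
  · intro hG
    convert facePiece_mul (fvx_mem (k := k) g j) ((hf G).1 hG) using 1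
    congr 1
    funext i
    rw [hγ]
    by_cases h : i = j
    · subst h; simp; ring
    · simp [h]
  · intro hG
    rw [(hf G).2 hG, mul_zero]

theorem mulKC_comm (ℓ : ℕ) (j : Fin n) (f : KCochain P k n) :
    koszulD P k n x ℓ (mulKC P k n x j f) = mulKC P k n x j (koszulD P k n x ℓ f) := by
  funext G
  rw [koszulD_apply, mulKC_apply, koszulD_apply, Finset.mul_sum]
  apply Finset.sum_congr rfl
  intro i hi
  rw [mul_smul_comm, mulKC_apply]
  congr 1
  ring

end PhiSec

section DL
variable {k : Type} [Field k] {G : ℕ → Type} [∀ m, AddCommGroup (G m)] [∀ m, Module k (G m)]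

theorem chn_trans (tr : ∀ m, G m →ₗ[k] G (m + 1)) (c : ∀ i j, i ≤ j → (G i →ₗ[k] G j))
    (c0 : ∀ i v, c i i le_rfl v = v)
    (c1 : ∀ i j (h : i ≤ j) v, c i (j + 1) (h.trans (Nat.le_succ j)) v = tr j (c i j h v))
    {i j : ℕ} (h : i ≤ j) (v : G i) :
    ∀ {l : ℕ} (h' : j ≤ l), c j l h' (c i j h v) = c i l (h.trans h') v := by
  intro l h'
  induction l, h' using Nat.le_induction with
  | base => rw [c0]
  | succ l hl ih => rw [c1 _ _ hl, ih, c1 _ _ (h.trans hl)]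

theorem chn_exists (c : ∀ i j, i ≤ j → (G i →ₗ[k] G j)) (L : ℕ)
    (z : Module.DirectLimit G c) :
    ∃ l, L ≤ l ∧ ∃ v : G l, Module.DirectLimit.of k ℕ G c l v = z := by
  obtain ⟨i, v, rfl⟩ := Module.DirectLimit.exists_of z
  refine ⟨max i L, le_max_right _ _, c _ _ (le_max_left i L) v, ?_⟩
  exact Module.DirectLimit.of_f

theorem chn_equiv (tr : ∀ m, G m →ₗ[k] G (m + 1)) (c : ∀ i j, i ≤ j → (G i →ₗ[k] G j))
    (c0 : ∀ i v, c i i le_rfl v = v)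
    (c1 : ∀ i j (h : i ≤ j) v, c i (j + 1) (h.trans (Nat.le_succ j)) v = tr j (c i j h v))
    {H : Type} [AddCommGroup H] [Module k H]
    (L : ℕ) (E : ∀ l, L ≤ l → G l ≃ₗ[k] H)
    (hE : ∀ l (h : L ≤ l) v, E (l + 1) (h.trans (Nat.le_succ l)) (tr l v) = E l h v) :
    ∃ e : Module.DirectLimit G c ≃ₗ[k] H,
      ∀ l (h : L ≤ l) v, e (Module.DirectLimit.of k ℕ G c l v) = E l h v := by
  have hch : ∀ l (h : L ≤ l) (v : G L), E l h (c L l h v) = E L le_rfl v := by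
    intro l h v
    induction l, h using Nat.le_induction with
    | base => rw [c0]
    | succ l hl ih => rw [c1 _ _ hl, hE l hl, ih]
  have hof : ∀ l (h : L ≤ l) (v : G l), Module.DirectLimit.of k ℕ G c l v =
      Module.DirectLimit.of k ℕ G c L ((E L le_rfl).symm (E l h v)) := by
    intro l h v
    have h1 : v = c L l h ((E L le_rfl).symm (E l h v)) := by
      apply (E l h).injective
      rw [hch, LinearEquiv.apply_symm_apply]
    conv_lhs => rw [h1]
    exact Module.DirectLimit.of_f
  have : DirectedSystem G (fun i j h => ⇑(c i j h)) :=
    { map_self := fun {i} v => c0 i v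
      map_map := fun {_ _ _} hij hjk v => chn_trans tr c c0 c1 hij v hjk }
  have bij : Function.Bijective (Module.DirectLimit.of k ℕ G c L) := by
    constructor
    · rw [injective_iff_map_eq_zero]
      intro v hv
      obtain ⟨l, hl, h0⟩ := Module.DirectLimit.of.zero_exact hv
      apply (E L le_rfl).injective
      rw [← hch l hl, h0, map_zero, map_zero]
    · intro z
      obtain ⟨l, hl, v, rfl⟩ := chn_exists c L z
      exact ⟨_, (hof l hl v).symm⟩
  refine ⟨(LinearEquiv.ofBijective _ bij).symm.trans (E L le_rfl), ?_⟩
  intro l h v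
  rw [hof l h v, LinearEquiv.trans_apply]
  have : (LinearEquiv.ofBijective _ bij).symm (Module.DirectLimit.of k ℕ G c L
      ((E L le_rfl).symm (E l h v))) = (E L le_rfl).symm (E l h v) := by
    rw [LinearEquiv.symm_apply_eq]; rfl
  rw [this, LinearEquiv.apply_symm_apply]

end DL

section Final
variable {P k n x}

set_option synthInstance.maxHeartbeats 1000000 in
theorem transExt_mk (g : Good x) {ℓ t : ℕ} {α : Fin n → ℤ} (v : ↥(ZK P k n x ℓ t α)) :
    ∃ hv : transKC P k n x v.1 ∈ ZK P k n x (ℓ + 1) t α,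
      transExt P k n x ℓ t α (Submodule.Quotient.mk v) =
        Submodule.Quotient.mk ⟨transKC P k n x v.1, hv⟩ := by
  have hz : ∀ v ∈ ZK P k n x ℓ t α, transKC P k n x v ∈ ZK P k n x (ℓ + 1) t α := by
    rintro v ⟨h1, h2⟩
    refine ⟨?_, trans_mem g h2⟩
    change koszulD P k n x (ℓ + 1) (transKC P k n x v) = 0
    rw [trans_comm, show koszulD P k n x ℓ v = 0 from h1, map_zero]
  have h : ∃ g : ↥(ZK P k n x ℓ t α) →ₗ[k] ↥(ZK P k n x (ℓ + 1) t α),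
      (∀ v : ↥(ZK P k n x ℓ t α),
        (g v : KCochain P k n) = transKC P k n x (v : KCochain P k n)) ∧
      Submodule.comap (ZK P k n x ℓ t α).subtype (BK P k n x ℓ t α) ≤
        (Submodule.comap (ZK P k n x (ℓ + 1) t α).subtype
          (BK P k n x (ℓ + 1) t α)).comap g := by
    refine ⟨(transKC P k n x).restrict hz, fun v => rfl, ?_⟩
    rintro v ⟨y, hy, hyv⟩
    refine ⟨transKC P k n x y, trans_mem g hy, ?_⟩
    rw [trans_comm, hyv]; rfl
  refine ⟨hz _ v.2, ?_⟩
  rw [transExt, dif_pos h, Submodule.mapQ_apply]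
  congr 1
  exact Subtype.ext (h.choose_spec.1 v)

set_option synthInstance.maxHeartbeats 1000000 in
theorem extMul_mk (g : Good x) {ℓ t : ℕ} {α γ : Fin n → ℤ} {j : Fin n}
    (hγ : γ = fun i => if i = j then α i + 1 else α i) (v : ↥(ZK P k n x ℓ t α)) :
    ∃ hv : mulKC P k n x j v.1 ∈ ZK P k n x ℓ t γ,
      extMul P k n x j ℓ t α γ (Submodule.Quotient.mk v) =
        Submodule.Quotient.mk ⟨mulKC P k n x j v.1, hv⟩ := by
  have hz : ∀ v ∈ ZK P k n x ℓ t α, mulKC P k n x j v ∈ ZK P k n x ℓ t γ := by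
    rintro v ⟨h1, h2⟩
    refine ⟨?_, mulKC_mem g hγ h2⟩
    change koszulD P k n x ℓ (mulKC P k n x j v) = 0
    rw [mulKC_comm, show koszulD P k n x ℓ v = 0 from h1, map_zero]
  have h : ∃ g : ↥(ZK P k n x ℓ t α) →ₗ[k] ↥(ZK P k n x ℓ t γ),
      (∀ v : ↥(ZK P k n x ℓ t α),
        (g v : KCochain P k n) = mulKC P k n x j (v : KCochain P k n)) ∧
      Submodule.comap (ZK P k n x ℓ t α).subtype (BK P k n x ℓ t α) ≤
        (Submodule.comap (ZK P k n x ℓ t γ).subtype (BK P k n x ℓ t γ)).comap g := by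
    refine ⟨(mulKC P k n x j).restrict hz, fun v => rfl, ?_⟩
    rintro v ⟨y, hy, hyv⟩
    refine ⟨mulKC P k n x j y, mulKC_mem g hγ hy, ?_⟩
    rw [mulKC_comm, hyv]; rfl
  refine ⟨hz _ v.2, ?_⟩
  rw [extMul, dif_pos h, Submodule.mapQ_apply]
  congr 1
  exact Subtype.ext (h.choose_spec.1 v)

theorem trans_mul_comm (j : Fin n) (f : KCochain P k n) :
    mulKC P k n x j (transKC P k n x f) = transKC P k n x (mulKC P k n x j f) := by
  funext G
  rw [mulKC_apply, transKC_apply, transKC_apply, mulKC_apply]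
  ring

set_option synthInstance.maxHeartbeats 1000000 in
theorem extMul_trans (g : Good x) {ℓ t : ℕ} {α γ : Fin n → ℤ} {j : Fin n}
    (hγ : γ = fun i => if i = j then α i + 1 else α i) (v : ExtPiece P k n x ℓ t α) :
    extMul P k n x j (ℓ + 1) t α γ (transExt P k n x ℓ t α v) =
      transExt P k n x ℓ t γ (extMul P k n x j ℓ t α γ v) := by
  obtain ⟨v, rfl⟩ := Submodule.Quotient.mk_surjective _ v
  obtain ⟨h1, e1⟩ := transExt_mk g v
  obtain ⟨h2, e2⟩ := extMul_mk g hγ v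
  rw [e1, e2]
  obtain ⟨h3, e3⟩ := extMul_mk g hγ (⟨_, h1⟩ : ↥(ZK P k n x (ℓ + 1) t α))
  obtain ⟨h4, e4⟩ := transExt_mk g (⟨_, h2⟩ : ↥(ZK P k n x ℓ t γ))
  rw [e3, e4]
  congr 1
  exact Subtype.ext (trans_mul_comm j v.1)

/-- target cohomology -/
abbrev TH (k : Type) [Field k] (g : Good x) (U : Set P) (t : ℤ) :=
  HH (cobd (DC k g)) (cg (DC k g) U t) (cg (DC k g) U (t - 1))

set_option synthInstance.maxHeartbeats 1000000 in
/-- evaluation identification -/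
def EE (g : Good x) (ℓ t : ℕ) {α : Fin n → ℤ} {U : Set P} (hU : Us x α = U) (hα : ∀ i, α i ≤ 0)
    (hl : ∀ i, -α i < ℓ) : ExtPiece P k n x ℓ t α ≃ₗ[k] TH k g U t :=
  (hU ▸ Phi_QI (k := k) g (t := t) hα hl : QI (koszulD P k n x ℓ) (gradedKC P k n x ℓ t α)
    (gradedKC P k n x ℓ (t - 1) α)
      (cobd (DC k g)) (cg (DC k g) U t) (cg (DC k g) U ((t : ℤ) - 1)) (Phi g)).equiv

set_option synthInstance.maxHeartbeats 1000000 in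
theorem EE_mk (g : Good x) (ℓ t : ℕ) {α : Fin n → ℤ} {U : Set P} (hU : Us x α = U)
    (hα : ∀ i, α i ≤ 0) (hl : ∀ i, -α i < ℓ) (v : ↥(ZK P k n x ℓ t α)) :
    ∃ hv, EE g ℓ t hU hα hl (Submodule.Quotient.mk v) =
      Submodule.Quotient.mk ⟨Phi g v.1, hv⟩ := ⟨_, rfl⟩

set_option synthInstance.maxHeartbeats 1000000 in
theorem EE_trans (g : Good x) (ℓ t : ℕ) {α : Fin n → ℤ} {U : Set P} (hU : Us x α = U)
    (hα : ∀ i, α i ≤ 0) (hl : ∀ i, -α i < ℓ) (hl' : ∀ i, -α i < (ℓ + 1 : ℕ))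
    (v : ExtPiece P k n x ℓ t α) :
    EE g (ℓ + 1) t hU hα hl' (transExt P k n x ℓ t α v) = EE g ℓ t hU hα hl v := by
  obtain ⟨v, rfl⟩ := Submodule.Quotient.mk_surjective _ v
  obtain ⟨h1, e1⟩ := transExt_mk g v
  obtain ⟨h2, e2⟩ := EE_mk g ℓ t hU hα hl v
  obtain ⟨h3, e3⟩ := EE_mk g (ℓ + 1) t hU hα hl' ⟨_, h1⟩
  rw [e1, e2, e3]
  congr 1
  exact Subtype.ext (Phi_trans g v.1)

set_option synthInstance.maxHeartbeats 1000000 in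
theorem EE_mul (g : Good x) (ℓ t : ℕ) {α γ : Fin n → ℤ} {U : Set P} (hU : Us x α = U)
    (hU' : Us x γ = U) {j : Fin n} (hγ : γ = fun i => if i = j then α i + 1 else α i)
    (hj : α j ≠ 0)
    (hα : ∀ i, α i ≤ 0) (hα' : ∀ i, γ i ≤ 0) (hl : ∀ i, -α i < ℓ) (hl' : ∀ i, -γ i < ℓ)
    (v : ExtPiece P k n x ℓ t α) :
    EE g ℓ t hU' hα' hl' (extMul P k n x j ℓ t α γ v) = EE g ℓ t hU hα hl v := by
  obtain ⟨v, rfl⟩ := Submodule.Quotient.mk_surjective _ v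
  obtain ⟨h1, e1⟩ := extMul_mk g hγ v
  obtain ⟨h2, e2⟩ := EE_mk g ℓ t hU hα hl v
  obtain ⟨h3, e3⟩ := EE_mk g ℓ t hU' hα' hl' ⟨_, h1⟩
  rw [e1, e2, e3]
  congr 1
  exact Subtype.ext (Phi_mul g hα hj v.2.2)

set_option synthInstance.maxHeartbeats 1000000 in
theorem transChain_self (t : ℕ) (α : Fin n → ℤ) (i : ℕ) (v : ExtPiece P k n x i t α) :
    transChain P k n x t α (le_refl i) v = v := by
  rw [transChain, Nat.leRecOn_self]; rfl

set_option synthInstance.maxHeartbeats 1000000 in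
theorem transChain_succ (t : ℕ) (α : Fin n → ℤ) (i j : ℕ) (h : i ≤ j)
    (v : ExtPiece P k n x i t α) :
    transChain P k n x t α (h.trans (Nat.le_succ j)) v =
      transExt P k n x j t α (transChain P k n x t α h v) := by
  rw [transChain, Nat.leRecOn_succ h]; rfl

set_option synthInstance.maxHeartbeats 1000000 in
theorem extMul_chain (g : Good x) {t : ℕ} {α γ : Fin n → ℤ} {j : Fin n}
    (hγ : γ = fun i => if i = j then α i + 1 else α i) {a b : ℕ} (hab : a ≤ b)
    (v : ExtPiece P k n x a t α) :
    extMul P k n x j b t α γ (transChain P k n x t α hab v) =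
        transChain P k n x t γ hab (extMul P k n x j a t α γ v) := by
  induction b, hab using Nat.le_induction with
  | base => rw [transChain_self, transChain_self]
  | succ l hl ih => rw [transChain_succ _ _ _ _ hl, extMul_trans g hγ, ih,
      transChain_succ _ _ _ _ hl]

set_option synthInstance.maxHeartbeats 1000000 in
theorem locMul_of (g : Good x) (l t : ℕ) {α γ : Fin n → ℤ} {j : Fin n}
    (hγ : γ = fun i => if i = j then α i + 1 else α i) (v : ExtPiece P k n x l t α) :
    locMul P k n x j t α γ (Module.DirectLimit.of k ℕ (fun m => ExtPiece P k n x m t α)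
      (fun _ _ h => transChain P k n x t α h) l v) =
    Module.DirectLimit.of k ℕ (fun m => ExtPiece P k n x m t γ)
      (fun _ _ h => transChain P k n x t γ h) l (extMul P k n x j l t α γ v) := by
  have h : ∀ (a b : ℕ) (hab : a ≤ b) (v : ExtPiece P k n x a t α),
      ((Module.DirectLimit.of k ℕ (fun m => ExtPiece P k n x m t γ)
          (fun _ _ hcd => transChain P k n x t γ hcd) b).comp (extMul P k n x j b t α γ))
        (transChain P k n x t α hab v) =
      ((Module.DirectLimit.of k ℕ (fun m => ExtPiece P k n x m t γ)
          (fun _ _ hcd => transChain P k n x t γ hcd) a).comp (extMul P k n x j a t α γ)) v := by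
    intro a b hab v
    rw [LinearMap.comp_apply, LinearMap.comp_apply, extMul_chain g hγ]
    exact Module.DirectLimit.of_f
  rw [locMul, dif_pos h, Module.DirectLimit.lift_of]
  rfl

set_option synthInstance.maxHeartbeats 1000000 in
theorem loc_equiv (g : Good x) (t L : ℕ) {α : Fin n → ℤ} {U : Set P} (hU : Us x α = U)
    (hα : ∀ i, α i ≤ 0) (hl : ∀ l, L ≤ l → ∀ i, -α i < (l : ℤ)) :
    ∃ e : LocCoh P k n x t α ≃ₗ[k] TH k g U t, ∀ l (h : L ≤ l) (v : ExtPiece P k n x l t α),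
      e (Module.DirectLimit.of k ℕ (fun m => ExtPiece P k n x m t α)
        (fun _ _ h => transChain P k n x t α h) l v) = EE g l t hU hα (hl l h) v :=
  chn_equiv (G := fun m => ExtPiece P k n x m t α) (fun m => transExt P k n x m t α)
    (fun _ _ h => transChain P k n x t α h)
    (transChain_self t α) (transChain_succ t α) L (fun l h => EE g l t hU hα (hl l h))
    (fun l h v => EE_trans g l t hU hα (hl l h) (hl (l + 1) (h.trans (Nat.le_succ l))) v)

set_option synthInstance.maxHeartbeats 1000000 in
theorem main_aux (g : Good x)
    (t : ℕ) (α γ : Fin n → ℤ) (j : Fin n)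
    (hα : ∀ i, α i ≤ 0) (hj : α j < -1)
    (hγ : γ = fun i => if i = j then α i + 1 else α i) :
    ∃ (eα : LocCoh P k n x t α ≃ₗ[k]
        ((w : {w : P // ∀ i : Fin n, x i ≤ w ↔ α i ≠ 0}) →
          RelCoh k P (cost (w : P)) ((t : ℤ) - 1)))
      (eγ : LocCoh P k n x t γ ≃ₗ[k]
        ((w : {w : P // ∀ i : Fin n, x i ≤ w ↔ α i ≠ 0}) →
          RelCoh k P (cost (w : P)) ((t : ℤ) - 1))),
      ∀ (u : LocCoh P k n x t α) (w : {w : P // ∀ i : Fin n, x i ≤ w ↔ α i ≠ 0}),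
        eγ (locMul P k n x j t α γ u) w = eα u w := by
  have hα' : ∀ i, γ i ≤ 0 := by
    intro i
    have := hα i
    rw [hγ]
    dsimp only
    split_ifs with h
    · subst h; omega
    · exact this
  have hge : ∀ i, α i ≤ γ i := by
    intro i
    rw [hγ]
    dsimp only
    split_ifs <;> omega
  have hU' : Us x γ = Us x α := by
    have : ∀ i, γ i ≠ 0 ↔ α i ≠ 0 := by
      intro i
      rw [hγ]
      dsimp only
      split_ifs with h
      · subst h; omega
      · rfl
    simp only [Us, this]
  let L : ℕ := (∑ i, (-α i).toNat) + 1
  have hl : ∀ l, L ≤ l → ∀ i, -α i < (l : ℤ) := by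
    intro l h i
    have h1 : (-α i).toNat ≤ ∑ i, (-α i).toNat :=
      Finset.single_le_sum (f := fun i => (-α i).toNat) (fun _ _ => Nat.zero_le _)
        (Finset.mem_univ i)
    omega
  have hl' : ∀ l, L ≤ l → ∀ i, -γ i < (l : ℤ) := by
    intro l h i
    have := hl l h i
    have := hge i
    omega
  obtain ⟨e1, he1⟩ := loc_equiv (k := k) g t L (U := Us x α) rfl hα hl
  obtain ⟨e2, he2⟩ := loc_equiv (k := k) g t L (U := Us x α) hU' hα' hl'
  obtain ⟨φ, hφ⟩ := QI_of_CC (C := DC k g) (C' := KC k) rfl (KC_bot k) (Us_upper (x := x) α) (t : ℤ)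
  have hspw : ∀ w : {w : P // ∀ i : Fin n, x i ≤ w ↔ α i ≠ 0}, ∀ i, i ∈ sp x w.1 ↔ α i ≠ 0 :=
    fun w i => mem_sp.trans (w.2 i)
  obtain ⟨ρ⟩ := KC_equiv_rel (k := k)
    (fun w : {w : P // ∀ i : Fin n, x i ≤ w ↔ α i ≠ 0} => (w : P))
    (by
      intro w h
      have h1 : x j ≤ w.1 := (w.2 j).2 (by omega)
      rw [show w.1 = ⊥ from h, le_bot_iff] at h1
      exact (g.hatom j).1 h1)
    (by
      intro w w' z h h'
      refine Subtype.ext (g.eq_of_sp h h' ?_)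
      ext i
      rw [hspw, hspw])
    (Us x α)
    (by
      intro z
      constructor
      · intro hz
        refine ⟨⟨fc g z (Finset.univ.filter fun i => α i ≠ 0), fun i => ?_⟩, fc_le g _ _⟩
        rw [← mem_sp, sp_fc, Finset.mem_inter, Finset.mem_filter, mem_sp]
        constructor
        · intro h; exact h.1.2
        · intro h; exact ⟨⟨Finset.mem_univ _, h⟩, hz i h⟩
      · rintro ⟨w, hw⟩ i hi
        exact ((w.2 i).2 hi).trans hw)
    (t : ℤ)
  refine ⟨(e1.trans hφ.equiv).trans ρ, (e2.trans hφ.equiv).trans ρ, ?_⟩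
  intro u w
  have key : e2 (locMul P k n x j t α γ u) = e1 u := by
    obtain ⟨l, hL, v, rfl⟩ := chn_exists (G := fun m => ExtPiece P k n x m t α)
      (fun _ _ h => transChain P k n x t α h) L u
    have h1 := locMul_of g l t hγ v
    have h2 := EE_mul g l t rfl hU' hγ (by omega) hα hα' (hl l hL) (hl' l hL) v
    exact (congrArg e2 h1).trans ((he2 l hL _).trans (h2.trans (he1 l hL v).symm))
  simp only [LinearEquiv.trans_apply, key]

end Final

/-- Theorem 4.5, case `αⱼ < -1`: under the Hochster-type identifications
`H_m^t(A_P)_α ≅ ⊕_{supp w = supp α} H^{t-1}(P, cost_P w)` (and likewise in degree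
`γ = α + eⱼ`, which has the same support), multiplication `·xⱼ` corresponds to the
direct sum of identity maps. -/
theorem locMul_eq_identity_of_lt_neg_one
    (hP : IsSimplicialPoset P)
    (hinj : Function.Injective x) (hatom : ∀ i, IsAtom (x i))
    (hsurj : ∀ a : P, IsAtom a → ∃ i, x i = a)
    (t : ℕ) (α γ : Fin n → ℤ) (j : Fin n)
    (hα : ∀ i, α i ≤ 0) (hj : α j < -1)
    (hγ : γ = fun i => if i = j then α i + 1 else α i) :
    ∃ (eα : LocCoh P k n x t α ≃ₗ[k]
        ((w : {w : P // ∀ i : Fin n, x i ≤ w ↔ α i ≠ 0}) →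
          RelCoh k P (cost (w : P)) ((t : ℤ) - 1)))
      (eγ : LocCoh P k n x t γ ≃ₗ[k]
        ((w : {w : P // ∀ i : Fin n, x i ≤ w ↔ α i ≠ 0}) →
          RelCoh k P (cost (w : P)) ((t : ℤ) - 1))),
      ∀ (u : LocCoh P k n x t α) (w : {w : P // ∀ i : Fin n, x i ≤ w ↔ α i ≠ 0}),
        eγ (locMul P k n x j t α γ u) w = eα u w := by
  exact main_aux ⟨hP, hinj, hatom, hsurj⟩ t α γ j hα hj hγ

end
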